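/- arXiv:2202.13561 — 3 statements merged into one kernel-verified Lean document; each statement's English description precedes it below -/
import Mathlib

section
/- For every ε₀ ∈ (0, π) and every A ≥ 1 there exist constants C > 0 and τ₀ ∈ (0,1), depending only on ε₀ and A, such that for all τ ∈ (0, τ₀), all t₁, t₂ with A⁻¹ τ^{−1/2} < t₁, t₂ < A τ^{−1/2}, and all P₁, P₂ ∈ S³ with geodesic distance d(P₁,P₂) ≥ ε₀, one has | ∫_{S³} δ_{P₁,t₁}(x)² δ_{P₂,t₂}(x) dx − 16π² · G_{P₁}(P₂)/(t₁ t₂) | ≤ C τ^{3/2}. -/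
open MeasureTheory Real Set Metric
open scoped RealInnerProductSpace

noncomputable section

/-- The unit sphere `S³ ⊂ ℝ⁴`. -/
abbrev S3 : Set (EuclideanSpace ℝ (Fin 4)) := Metric.sphere (0 : EuclideanSpace ℝ (Fin 4)) 1

/-- The surface (Riemannian volume) measure on `S³`, realized as the measure on the unit
sphere induced by the Lebesgue measure of `ℝ⁴` (so that the total mass is `2π²`). -/
def μS3 : Measure S3 := (volume : Measure (EuclideanSpace ℝ (Fin 4))).toSphere

/-- The standard bubble `δ_{P,t}(x) = t / (1 + ((t²−1)/2)(1 − ⟨x,P⟩))` on `S³`. -/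
def bubble (P : S3) (t : ℝ) (x : S3) : ℝ :=
  t / (1 + ((t ^ 2 - 1) / 2) *
    (1 - ⟪(x : EuclideanSpace ℝ (Fin 4)), (P : EuclideanSpace ℝ (Fin 4))⟫))

/-- The geodesic distance on the unit sphere: `d(P,Q) = arccos ⟨P,Q⟩`. -/
def geoDist (P Q : S3) : ℝ :=
  Real.arccos ⟪(P : EuclideanSpace ℝ (Fin 4)), (Q : EuclideanSpace ℝ (Fin 4))⟫

/-- The Green's function `G_P(Q) = 1/(1 − ⟨P,Q⟩) = 1/(1 − cos d(P,Q))`. -/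
def green (P Q : S3) : ℝ :=
  1 / (1 - ⟪(P : EuclideanSpace ℝ (Fin 4)), (Q : EuclideanSpace ℝ (Fin 4))⟫)


/-- A linear isometry of a normed space, restricted to the unit sphere. -/
def sphereMap {E : Type*} [NormedAddCommGroup E] [NormedSpace ℝ E] (L : E ≃ₗᵢ[ℝ] E)
    (x : sphere (0 : E) 1) : sphere (0 : E) 1 :=
  ⟨L x, by simp⟩

open scoped Pointwise in
lemma measurePreserving_sphereMap {E : Type*} [NormedAddCommGroup E] [InnerProductSpace ℝ E]
    [FiniteDimensional ℝ E] [MeasurableSpace E] [BorelSpace E] (L : E ≃ₗᵢ[ℝ] E) :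
    MeasurePreserving (sphereMap L) (volume : Measure E).toSphere
      (volume : Measure E).toSphere := by
  have hcont : Continuous (sphereMap L) :=
    Continuous.subtype_mk (L.continuous.comp continuous_subtype_val) _
  refine ⟨hcont.measurable, ?_⟩
  ext s hs
  rw [Measure.map_apply hcont.measurable hs, Measure.toSphere_apply' _ hs,
    Measure.toSphere_apply' _ (hcont.measurable hs)]
  have hpre : (Ioo (0 : ℝ) 1) • ((↑) '' (sphereMap L ⁻¹' s) : Set E) =
      L ⁻¹' ((Ioo (0 : ℝ) 1) • ((↑) '' s : Set E)) := by
    ext y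
    simp only [Set.mem_smul, Set.mem_preimage, Set.mem_image]
    constructor
    · rintro ⟨r, hr, _, ⟨x, hx, rfl⟩, rfl⟩
      exact ⟨r, hr, _, ⟨_, hx, rfl⟩, by simp [sphereMap]⟩
    · rintro ⟨r, hr, _, ⟨x, hx, rfl⟩, h⟩
      refine ⟨r, hr, _, ⟨sphereMap L.symm x, ?_, rfl⟩, ?_⟩
      · simpa [sphereMap] using hx
      · apply L.injective
        simpa [sphereMap] using h
  rw [hpre, L.measurePreserving.measure_preimage_emb L.toHomeomorph.measurableEmbedding]

lemma lintegral_norm_mul_direction {E : Type*} [NormedAddCommGroup E] [InnerProductSpace ℝ E]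
    [FiniteDimensional ℝ E] [Nontrivial E] [MeasurableSpace E] [BorelSpace E]
    {h : ℝ → ENNReal} (hh : Measurable h) {F : E → ENNReal} (hF : Measurable F) :
    ∫⁻ y : E, F (‖y‖⁻¹ • y) * h ‖y‖ =
      (∫⁻ x, F x ∂(volume : Measure E).toSphere) *
        ∫⁻ r in Ioi (0 : ℝ), ENNReal.ofReal (r ^ (Module.finrank ℝ E - 1)) * h r := by
  have hmp := (volume : Measure E).measurePreserving_homeomorphUnitSphereProd
  calc ∫⁻ y : E, F (‖y‖⁻¹ • y) * h ‖y‖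
      = ∫⁻ y : ({(0 : E)}ᶜ : Set E), F (‖y.1‖⁻¹ • y.1) * h ‖y.1‖ ∂(volume.comap Subtype.val) := by
        rw [lintegral_subtype_comap (measurableSet_singleton _).compl
          (fun y : E => F (‖y‖⁻¹ • y) * h ‖y‖), restrict_compl_singleton]
    _ = ∫⁻ p, F p.1 * h p.2 ∂((volume : Measure E).toSphere.prod
          (.volumeIoiPow (Module.finrank ℝ E - 1))) := by
        rw [← hmp.lintegral_comp (by fun_prop)]
        simp
    _ = (∫⁻ x, F x ∂(volume : Measure E).toSphere) *
          ∫⁻ r : Ioi (0 : ℝ), h r ∂(.volumeIoiPow (Module.finrank ℝ E - 1)) :=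
        lintegral_prod_mul (f := fun x : sphere (0 : E) 1 => F x)
          (g := fun r : Ioi (0 : ℝ) => h r) (by fun_prop) (by fun_prop)
    _ = _ := by
        congr 1
        rw [Measure.volumeIoiPow, lintegral_withDensity_eq_lintegral_mul _ (by fun_prop)
          (by fun_prop), ← lintegral_subtype_comap measurableSet_Ioi]
        rfl

lemma lintegral_fun_norm_euclidean_three {h : ℝ → ENNReal} (hh : Measurable h) :
    ∫⁻ z : EuclideanSpace ℝ (Fin 3), h ‖z‖ =
      ENNReal.ofReal (4 * π) * ∫⁻ r in Ioi (0 : ℝ), ENNReal.ofReal (r ^ 2) * h r := by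
  have := lintegral_norm_mul_direction (E := EuclideanSpace ℝ (Fin 3)) hh
    (F := fun _ => 1) measurable_const
  simp only [one_mul, lintegral_const, finrank_euclideanSpace, Fintype.card_fin,
    Nat.add_one_sub_one, Measure.toSphere_apply_univ, EuclideanSpace.volume_ball_fin_three] at this
  rw [this]
  congr 1
  rw [ENNReal.ofReal_one, one_pow, one_mul, ← ENNReal.ofReal_natCast,
    ← ENNReal.ofReal_mul (by positivity)]
  congr 1
  push_cast
  ring

lemma lintegral_euclidean_four {g : ℝ → ℝ → ENNReal} (hg : Measurable (Function.uncurry g)) :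
    ∫⁻ y : EuclideanSpace ℝ (Fin 4), g (y 0) ‖y‖ =
      ∫⁻ s : ℝ, ∫⁻ z : EuclideanSpace ℝ (Fin 3), g s (√(s ^ 2 + ‖z‖ ^ 2)) := by
  have h1 := (PiLp.volume_preserving_toLp (Fin 4)).lintegral_comp
    (f := fun y : EuclideanSpace ℝ (Fin 4) => g (y 0) ‖y‖)
    (hg.comp (f := fun y : EuclideanSpace ℝ (Fin 4) => (y 0, ‖y‖)) (by fun_prop))
  rw [← h1]
  have h2 := ((volume_preserving_piFinSuccAbove (fun _ : Fin 4 => ℝ) 0).symm).lintegral_comp_emb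
    (MeasurableEquiv.measurableEmbedding _)
    (fun y : Fin 4 → ℝ => g (y 0) ‖WithLp.toLp 2 y‖)
  have h3 : ∀ (s : ℝ) (z : Fin 3 → ℝ), ‖WithLp.toLp 2 (Fin.cons s z : Fin 4 → ℝ)‖
      = √(s ^ 2 + ‖WithLp.toLp 2 z‖ ^ 2) := by
    intro s z
    rw [EuclideanSpace.norm_eq, EuclideanSpace.norm_sq_eq, Fin.sum_univ_succ]
    simp
  calc ∫⁻ y : Fin 4 → ℝ, g (y 0) ‖WithLp.toLp 2 y‖
      = ∫⁻ p : ℝ × (Fin 3 → ℝ), g p.1 (√(p.1 ^ 2 + ‖WithLp.toLp 2 p.2‖ ^ 2)) := by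
        rw [← h2]
        refine lintegral_congr fun p => ?_
        simp only [MeasurableEquiv.piFinSuccAbove_symm_apply, Fin.insertNthEquiv_zero,
          Fin.consEquiv_apply, Fin.cons_zero]
        exact congrArg (g p.1) (h3 _ _)
    _ = ∫⁻ s : ℝ, ∫⁻ z : Fin 3 → ℝ, g s (√(s ^ 2 + ‖WithLp.toLp 2 z‖ ^ 2)) := by
        rw [Measure.volume_eq_prod, lintegral_prod]
        exact (hg.comp (f := fun p : ℝ × (Fin 3 → ℝ) =>
          (p.1, √(p.1 ^ 2 + ‖WithLp.toLp 2 p.2‖ ^ 2))) (by fun_prop)).aemeasurable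
    _ = _ := by
        refine lintegral_congr fun s => ?_
        exact (PiLp.volume_preserving_toLp (Fin 3)).lintegral_comp
          (f := fun z : EuclideanSpace ℝ (Fin 3) => g s (√(s ^ 2 + ‖z‖ ^ 2)))
          (hg.comp (f := fun z : EuclideanSpace ℝ (Fin 3) => (s, √(s ^ 2 + ‖z‖ ^ 2)))
            (by fun_prop))

lemma lintegral_upper_half_plane {g : ℝ → ℝ → ENNReal} (hg : Measurable (Function.uncurry g)) :
    ∫⁻ s : ℝ, ∫⁻ r in Ioi (0 : ℝ), g s r =
      ∫⁻ r in Ioi (0 : ℝ), ∫⁻ θ in Ioo 0 π,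
        ENNReal.ofReal r * g (r * cos θ) (r * sin θ) := by
  have hS : MeasurableSet {p : ℝ × ℝ | 0 < p.2} := measurableSet_lt measurable_const measurable_snd
  have hm : Measurable ({p : ℝ × ℝ | 0 < p.2}.indicator (Function.uncurry g)) := hg.indicator hS
  calc ∫⁻ s : ℝ, ∫⁻ r in Ioi (0 : ℝ), g s r
      = ∫⁻ p : ℝ × ℝ, {p : ℝ × ℝ | 0 < p.2}.indicator (Function.uncurry g) p := by
        rw [Measure.volume_eq_prod, lintegral_prod _ hm.aemeasurable]
        refine lintegral_congr fun s => ?_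
        rw [← lintegral_indicator measurableSet_Ioi]
        rfl
    _ = ∫⁻ r in Ioi (0 : ℝ), ∫⁻ θ in Ioo (-π) π, ENNReal.ofReal r *
          {p : ℝ × ℝ | 0 < p.2}.indicator (Function.uncurry g) (r * cos θ, r * sin θ) := by
        rw [← lintegral_comp_polarCoord_symm, polarCoord_target, Measure.volume_eq_prod,
          setLIntegral_prod]
        · simp
        · refine Measurable.aemeasurable ?_
          exact (by fun_prop : Measurable fun p : ℝ × ℝ => ENNReal.ofReal p.1).mul
            (hm.comp continuous_polarCoord_symm.measurable)
    _ = _ := by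
        refine setLIntegral_congr_fun measurableSet_Ioi fun r (hr : 0 < r) => ?_
        rw [← lintegral_indicator measurableSet_Ioo, ← lintegral_indicator measurableSet_Ioo]
        refine lintegral_congr fun θ => ?_
        by_cases h0 : θ ∈ Ioo 0 π
        · have h1 : θ ∈ Ioo (-π) π := ⟨by linarith [h0.1, pi_pos], h0.2⟩
          have h2 : 0 < r * sin θ := mul_pos hr (sin_pos_of_mem_Ioo h0)
          simp [h0, h1, h2]
        · by_cases h1 : θ ∈ Ioo (-π) π
          · have h2 : ¬ 0 < r * sin θ := by
              have : θ ≤ 0 := by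
                by_contra hc
                exact h0 ⟨not_le.1 hc, h1.2⟩
              have := sin_nonpos_of_nonpos_of_neg_pi_le this h1.1.le
              exact not_lt.2 (mul_nonpos_of_nonneg_of_nonpos hr.le this)
            simp [h0, h1, h2]
          · simp [h0, h1]

lemma lintegral_sphere_coord_zero {f : ℝ → ENNReal} (hf : Measurable f) :
    ∫⁻ x : S3, f ((x : EuclideanSpace ℝ (Fin 4)) 0) ∂μS3 =
      ENNReal.ofReal (4 * π) * ∫⁻ θ in Ioo 0 π, ENNReal.ofReal (sin θ ^ 2) * f (cos θ) := by
  set h : ℝ → ENNReal := fun r => ENNReal.ofReal (exp (-r))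
  have hh : Measurable h := by fun_prop
  set c : ENNReal := ∫⁻ r in Ioi (0 : ℝ), ENNReal.ofReal (r ^ 3) * h r with hc
  have hc_eq : c = ∫⁻ r in Ioi (0 : ℝ), ENNReal.ofReal (exp (-r) * r ^ (4 - 1 : ℝ)) := by
    refine setLIntegral_congr_fun measurableSet_Ioi fun r (hr : 0 < r) => ?_
    rw [mul_comm, ← ENNReal.ofReal_mul (by positivity)]
    norm_num
  have hc_top : c ≠ ⊤ := by
    rw [hc_eq]
    exact (GammaIntegral_convergent (s := 4) (by norm_num)).lintegral_lt_top.ne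
  have hc_zero : c ≠ 0 := by
    rw [hc_eq]
    refine (setLIntegral_pos_iff (by fun_prop)).2 ?_ |>.ne'
    have : Function.support (fun r : ℝ => ENNReal.ofReal (exp (-r) * r ^ (4 - 1 : ℝ))) ∩ Ioi 0 =
        Ioi 0 := by
      refine inter_eq_right.2 fun r (hr : 0 < r) => ?_
      rw [Function.mem_support]
      exact (ENNReal.ofReal_pos.2 (by positivity)).ne'
    rw [this]
    simp
  have hA := lintegral_norm_mul_direction (E := EuclideanSpace ℝ (Fin 4)) hh
    (F := fun y => f (y 0)) (by fun_prop)
  simp only [finrank_euclideanSpace, Fintype.card_fin, PiLp.smul_apply, smul_eq_mul] at hA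
  have hB := lintegral_euclidean_four (g := fun s r => f (r⁻¹ * s) * h r) (by
    unfold Function.uncurry; fun_prop)
  have hC : ∀ s : ℝ, ∫⁻ z : EuclideanSpace ℝ (Fin 3),
      f ((√(s ^ 2 + ‖z‖ ^ 2))⁻¹ * s) * h (√(s ^ 2 + ‖z‖ ^ 2)) =
      ENNReal.ofReal (4 * π) * ∫⁻ r in Ioi (0 : ℝ), ENNReal.ofReal (r ^ 2) *
        (f ((√(s ^ 2 + r ^ 2))⁻¹ * s) * h (√(s ^ 2 + r ^ 2))) := fun s =>
    lintegral_fun_norm_euclidean_three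
      (h := fun r => f ((√(s ^ 2 + r ^ 2))⁻¹ * s) * h (√(s ^ 2 + r ^ 2))) (by fun_prop)
  have hD := lintegral_upper_half_plane (g := fun s r => ENNReal.ofReal (r ^ 2) *
        (f ((√(s ^ 2 + r ^ 2))⁻¹ * s) * h (√(s ^ 2 + r ^ 2)))) (by
    unfold Function.uncurry; fun_prop)
  have hE : ∫⁻ r in Ioi (0 : ℝ), ∫⁻ θ in Ioo 0 π, ENNReal.ofReal r *
      (ENNReal.ofReal ((r * sin θ) ^ 2) *
        (f ((√((r * cos θ) ^ 2 + (r * sin θ) ^ 2))⁻¹ * (r * cos θ)) *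
          h (√((r * cos θ) ^ 2 + (r * sin θ) ^ 2)))) =
      (∫⁻ θ in Ioo 0 π, ENNReal.ofReal (sin θ ^ 2) * f (cos θ)) * c := by
    rw [hc, ← lintegral_const_mul _ (by fun_prop)]
    refine setLIntegral_congr_fun measurableSet_Ioi fun r (hr : 0 < r) => ?_
    rw [← lintegral_mul_const _ (by fun_prop)]
    refine lintegral_congr fun θ => ?_
    have h1 : √((r * cos θ) ^ 2 + (r * sin θ) ^ 2) = r := by
      rw [mul_pow, mul_pow, ← mul_add, cos_sq_add_sin_sq, mul_one, sqrt_sq hr.le]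
    rw [h1, inv_mul_cancel_left₀ hr.ne', mul_pow, ENNReal.ofReal_mul (by positivity),
      show r ^ 3 = r * r ^ 2 by ring, ENNReal.ofReal_mul hr.le]
    ring
  simp only [hC] at hB
  rw [lintegral_const_mul _ (by fun_prop), hD, hE, hA, ← mul_assoc] at hB
  exact (ENNReal.mul_left_inj hc_zero hc_top).1 hB

lemma lintegral_sphere_inner {f : ℝ → ENNReal} (hf : Measurable f) (P : S3) :
    ∫⁻ x : S3, f ⟪(x : EuclideanSpace ℝ (Fin 4)), (P : EuclideanSpace ℝ (Fin 4))⟫ ∂μS3 =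
      ENNReal.ofReal (4 * π) * ∫⁻ θ in Ioo 0 π, ENNReal.ofReal (sin θ ^ 2) * f (cos θ) := by
  set e : EuclideanSpace ℝ (Fin 4) := EuclideanSpace.single 0 1 with he
  have hn : ‖e‖ = ‖(P : EuclideanSpace ℝ (Fin 4))‖ := by simp [he]
  set L := (ℝ ∙ (e - (P : EuclideanSpace ℝ (Fin 4))))ᗮ.reflection with hL
  have hLe : L e = P := Submodule.reflection_sub hn
  rw [← lintegral_sphere_coord_zero hf, μS3,
    ← (measurePreserving_sphereMap L).lintegral_comp (by fun_prop)]
  refine lintegral_congr fun x => ?_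
  have : ⟪L x, (P : EuclideanSpace ℝ (Fin 4))⟫ = (x : EuclideanSpace ℝ (Fin 4)) 0 := by
    rw [← hLe, L.inner_map_map, he]
    simp [EuclideanSpace.inner_single_right]
  exact congrArg f this

lemma integral_sphere_inner {f : ℝ → ℝ} (hf : Measurable f) (hf0 : ∀ u ∈ Icc (-1 : ℝ) 1, 0 ≤ f u)
    (P : S3) :
    ∫ x : S3, f ⟪(x : EuclideanSpace ℝ (Fin 4)), (P : EuclideanSpace ℝ (Fin 4))⟫ ∂μS3 =
      4 * π * ∫ θ in 0..π, sin θ ^ 2 * f (cos θ) := by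
  have hx (x : S3) : 0 ≤ f ⟪(x : EuclideanSpace ℝ (Fin 4)), (P : EuclideanSpace ℝ (Fin 4))⟫ := by
    refine hf0 _ (abs_le.1 ?_)
    simpa using abs_real_inner_le_norm (x : EuclideanSpace ℝ (Fin 4)) P
  rw [integral_eq_lintegral_of_nonneg_ae (.of_forall hx)
      (Measurable.aestronglyMeasurable (by fun_prop)),
    lintegral_sphere_inner (f := fun u => ENNReal.ofReal (f u)) (by fun_prop),
    ENNReal.toReal_mul, ENNReal.toReal_ofReal (by positivity),
    intervalIntegral.integral_of_le pi_pos.le, integral_Ioc_eq_integral_Ioo,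
    integral_eq_lintegral_of_nonneg_ae
      (.of_forall fun θ => mul_nonneg (sq_nonneg _) (hf0 _ (cos_mem_Icc θ)))
      (Measurable.aestronglyMeasurable (by fun_prop))]
  simp only [ENNReal.ofReal_mul (sq_nonneg _)]

lemma hasDerivAt_arctan_poisson {t : ℝ} (ht : 1 < t) (θ : ℝ) :
    HasDerivAt (fun θ => (θ + 2 * arctan ((t - 1) * sin θ / ((t + 1) - (t - 1) * cos θ))) / (2 * t))
      (1 / ((t ^ 2 + 1) - (t ^ 2 - 1) * cos θ)) θ := by
  have hM : 0 < (t + 1) - (t - 1) * cos θ := by nlinarith [cos_le_one θ]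
  have hN : 0 < (t ^ 2 + 1) - (t ^ 2 - 1) * cos θ := by
    nlinarith [mul_nonneg (show 0 ≤ t ^ 2 - 1 by nlinarith) (sub_nonneg.2 (cos_le_one θ))]
  have h1 : HasDerivAt (fun θ => (t - 1) * sin θ) ((t - 1) * cos θ) θ :=
    (hasDerivAt_sin θ).const_mul _
  have h2 : HasDerivAt (fun θ => (t + 1) - (t - 1) * cos θ) (-((t - 1) * -sin θ)) θ :=
    ((hasDerivAt_cos θ).const_mul _).const_sub _
  have h4 := (((hasDerivAt_id θ).fun_add ((h1.fun_div h2 hM.ne').arctan.const_mul 2)).div_const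
    (2 * t))
  refine h4.congr_deriv ?_
  have hsq : sin θ ^ 2 = 1 - cos θ ^ 2 := sin_sq θ
  have hnum : (t - 1) * cos θ * ((t + 1) - (t - 1) * cos θ) -
      (t - 1) * sin θ * -((t - 1) * -sin θ) = (t - 1) * ((t + 1) * cos θ - (t - 1)) := by
    linear_combination (-(t - 1) ^ 2) * hsq
  have hsum : 1 + ((t - 1) * sin θ / ((t + 1) - (t - 1) * cos θ)) ^ 2 =
      2 * ((t ^ 2 + 1) - (t ^ 2 - 1) * cos θ) / ((t + 1) - (t - 1) * cos θ) ^ 2 := by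
    field_simp
    linear_combination (t - 1) ^ 2 * hsq
  have hcancel {M N c : ℝ} (hM : 0 < M) (hN : 0 < N) :
      2 * (1 / (2 * N / M ^ 2) * (c / M ^ 2)) = c / N := by
    field_simp
  rw [hsum, hnum, hcancel hM hN]
  rw [div_eq_div_iff (by linarith) hN.ne', add_mul, div_mul_cancel₀ _ hN.ne']
  ring

lemma integral_sin_sq_mul_bubble_sq {t : ℝ} (ht : 1 < t) :
    ∫ θ in 0..π, sin θ ^ 2 * (t / (1 + ((t ^ 2 - 1) / 2) * (1 - cos θ))) ^ 2 =
      2 * π * t / (t + 1) ^ 2 := by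
  have hk : 0 < t ^ 2 - 1 := by nlinarith
  have hN (θ : ℝ) : 0 < (t ^ 2 + 1) - (t ^ 2 - 1) * cos θ := by nlinarith [cos_le_one θ]
  have hD (θ : ℝ) : 0 < 1 + ((t ^ 2 - 1) / 2) * (1 - cos θ) := by nlinarith [cos_le_one θ]
  set Ψ : ℝ → ℝ := fun θ =>
    (θ + 2 * arctan ((t - 1) * sin θ / ((t + 1) - (t - 1) * cos θ))) / (2 * t)
  have hder (θ : ℝ) : HasDerivAt
      (fun θ => 4 * t ^ 2 / (t ^ 2 - 1) * (-(sin θ / ((t ^ 2 + 1) - (t ^ 2 - 1) * cos θ)) +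
        ((t ^ 2 + 1) * Ψ θ - θ) / (t ^ 2 - 1)))
      (sin θ ^ 2 * (t / (1 + ((t ^ 2 - 1) / 2) * (1 - cos θ))) ^ 2) θ := by
    have h2 : HasDerivAt (fun θ => (t ^ 2 + 1) - (t ^ 2 - 1) * cos θ) (-((t ^ 2 - 1) * -sin θ)) θ :=
      ((hasDerivAt_cos θ).const_mul _).const_sub _
    have h3 := ((((hasDerivAt_sin θ).fun_div h2 (hN θ).ne').fun_neg).fun_add
      ((((hasDerivAt_arctan_poisson ht θ).const_mul (t ^ 2 + 1)).fun_sub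
        (hasDerivAt_id θ)).div_const (t ^ 2 - 1))).const_mul (4 * t ^ 2 / (t ^ 2 - 1))
    refine h3.congr_deriv ?_
    have hND : 1 + ((t ^ 2 - 1) / 2) * (1 - cos θ) = ((t ^ 2 + 1) - (t ^ 2 - 1) * cos θ) / 2 := by
      ring
    rw [hND]
    have := (hN θ).ne'
    field_simp
    ring
  rw [intervalIntegral.integral_eq_sub_of_hasDerivAt (fun θ _ => hder θ)]
  · simp only [Ψ, sin_pi, sin_zero, cos_pi, cos_zero, mul_zero, zero_div, arctan_zero, neg_zero,
      add_zero, zero_add, sub_zero]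
    have : t ^ 2 - 1 = (t - 1) * (t + 1) := by ring
    have h1 : t - 1 ≠ 0 := by linarith
    rw [this]
    field_simp
    ring
  · refine Continuous.intervalIntegrable ?_ _ _
    exact (by fun_prop : Continuous fun θ => sin θ ^ 2).mul
      ((continuous_const.div (by fun_prop) fun θ => (hD θ).ne').pow 2)

lemma integral_sin_sq_mul_bubble_le {t : ℝ} (ht : 1 < t) :
    ∫ θ in 0..π, sin θ ^ 2 * (t / (1 + ((t ^ 2 - 1) / 2) * (1 - cos θ))) ≤
      2 * π * (t / ((t ^ 2 - 1) / 2)) := by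
  have hk : 0 < (t ^ 2 - 1) / 2 := by nlinarith
  have hD (θ : ℝ) : 0 < 1 + ((t ^ 2 - 1) / 2) * (1 - cos θ) := by nlinarith [cos_le_one θ]
  have hle (θ : ℝ) : sin θ ^ 2 * (t / (1 + ((t ^ 2 - 1) / 2) * (1 - cos θ))) ≤
      2 * (t / ((t ^ 2 - 1) / 2)) := by
    have h1 : sin θ ^ 2 * ((t ^ 2 - 1) / 2) ≤ 2 * (1 + ((t ^ 2 - 1) / 2) * (1 - cos θ)) := by
      have h2 : sin θ ^ 2 ≤ 2 * (1 - cos θ) := by nlinarith [sin_sq θ, cos_le_one θ]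
      nlinarith
    rw [← mul_div_assoc, ← mul_div_assoc, div_le_div_iff₀ (hD θ) hk]
    nlinarith
  have := intervalIntegral.norm_integral_le_of_norm_le_const (a := 0) (b := π)
    (f := fun θ => sin θ ^ 2 * (t / (1 + ((t ^ 2 - 1) / 2) * (1 - cos θ))))
    (C := 2 * (t / ((t ^ 2 - 1) / 2))) (fun θ _ => by
      rw [norm_of_nonneg (mul_nonneg (sq_nonneg _) (div_nonneg (by linarith) (hD θ).le))]
      exact hle θ)
  rw [sub_zero, abs_of_pos pi_pos] at this
  calc _ ≤ _ := le_norm_self _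
    _ ≤ _ := this
    _ = _ := by ring

lemma sphere_inner_le_one (x P : S3) :
    ⟪(x : EuclideanSpace ℝ (Fin 4)), (P : EuclideanSpace ℝ (Fin 4))⟫ ≤ 1 := by
  simpa using real_inner_le_norm (x : EuclideanSpace ℝ (Fin 4)) P

lemma bubble_denom_pos {t : ℝ} (ht : 1 < t) {u : ℝ} (hu : u ≤ 1) :
    0 < 1 + ((t ^ 2 - 1) / 2) * (1 - u) := by
  have := mul_nonneg (show 0 ≤ (t ^ 2 - 1) / 2 by nlinarith) (sub_nonneg.2 hu)
  linarith

lemma bubble_pos (P : S3) {t : ℝ} (ht : 1 < t) (x : S3) : 0 < bubble P t x :=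
  div_pos (by linarith) (bubble_denom_pos ht (sphere_inner_le_one x P))

lemma continuous_bubble (P : S3) {t : ℝ} (ht : 1 < t) : Continuous (bubble P t) :=
  continuous_const.div (by fun_prop) fun x => (bubble_denom_pos ht (sphere_inner_le_one x P)).ne'

instance : IsFiniteMeasure μS3 := inferInstanceAs (IsFiniteMeasure (Measure.toSphere _))

lemma integrable_of_continuous_sphere {f : S3 → ℝ} (hf : Continuous f) : Integrable f μS3 :=
  hf.integrable_of_hasCompactSupport (.of_compactSpace f)

lemma integral_bubble_sq (P : S3) {t : ℝ} (ht : 1 < t) :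
    ∫ x, bubble P t x ^ 2 ∂μS3 = 8 * π ^ 2 * (t / (t + 1) ^ 2) := by
  have := integral_sphere_inner (f := fun u => (t / (1 + ((t ^ 2 - 1) / 2) * (1 - u))) ^ 2)
    (by fun_prop) (fun u _ => sq_nonneg _) P
  rw [integral_sin_sq_mul_bubble_sq ht] at this
  refine this.trans ?_
  ring

lemma integral_bubble_le (P : S3) {t : ℝ} (ht : 2 ≤ t) :
    ∫ x, bubble P t x ∂μS3 ≤ 24 * π ^ 2 * t⁻¹ := by
  have ht1 : 1 < t := by linarith
  have := integral_sphere_inner (f := fun u => t / (1 + ((t ^ 2 - 1) / 2) * (1 - u)))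
    (by fun_prop) (fun u hu => div_nonneg (by linarith) (bubble_denom_pos ht1 hu.2).le) P
  refine this.trans_le ?_
  have h1 : t / ((t ^ 2 - 1) / 2) ≤ 3 * t⁻¹ := by
    rw [← div_eq_mul_inv, div_le_div_iff₀ (by nlinarith) (by linarith)]
    nlinarith
  calc _ ≤ 4 * π * (2 * π * (t / ((t ^ 2 - 1) / 2))) := by
        gcongr
        exact integral_sin_sq_mul_bubble_le ht1
    _ ≤ 4 * π * (2 * π * (3 * t⁻¹)) := by gcongr
    _ = _ := by ring

lemma integral_bubble_sq_mul_inner (P Q : S3) {t : ℝ} (ht : 1 < t) :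
    ∫ x : S3, bubble P t x ^ 2 *
        ⟪(x : EuclideanSpace ℝ (Fin 4)), (Q : EuclideanSpace ℝ (Fin 4))⟫ ∂μS3 =
      ⟪(P : EuclideanSpace ℝ (Fin 4)), (Q : EuclideanSpace ℝ (Fin 4))⟫ *
        ∫ x : S3, bubble P t x ^ 2 *
          ⟪(x : EuclideanSpace ℝ (Fin 4)), (P : EuclideanSpace ℝ (Fin 4))⟫ ∂μS3 := by
  have hb := continuous_bubble P ht
  set L := (ℝ ∙ (P : EuclideanSpace ℝ (Fin 4))).reflection with hL
  have hLx (x : EuclideanSpace ℝ (Fin 4)) :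
      L x = (2 * ⟪(P : EuclideanSpace ℝ (Fin 4)), x⟫) • (P : EuclideanSpace ℝ (Fin 4)) - x := by
    rw [hL, Submodule.reflection_singleton_apply]
    simp [two_mul, add_smul, two_smul]
  have hP : ⟪(P : EuclideanSpace ℝ (Fin 4)), (P : EuclideanSpace ℝ (Fin 4))⟫ = 1 := by simp
  have hin (x : S3) (R : S3) :
      ⟪(sphereMap L x : EuclideanSpace ℝ (Fin 4)), (R : EuclideanSpace ℝ (Fin 4))⟫ =
      2 * ⟪(x : EuclideanSpace ℝ (Fin 4)), (P : EuclideanSpace ℝ (Fin 4))⟫ *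
        ⟪(P : EuclideanSpace ℝ (Fin 4)), (R : EuclideanSpace ℝ (Fin 4))⟫ -
      ⟪(x : EuclideanSpace ℝ (Fin 4)), (R : EuclideanSpace ℝ (Fin 4))⟫ := by
    change ⟪L x, (R : EuclideanSpace ℝ (Fin 4))⟫ = _
    rw [hLx, inner_sub_left, real_inner_smul_left, real_inner_comm]
  have hbub (x : S3) : bubble P t (sphereMap L x) = bubble P t x := by
    rw [bubble, bubble, hin, hP]
    ring_nf
  have hmp : MeasurePreserving (sphereMap L) μS3 μS3 := measurePreserving_sphereMap L
  have hF : Continuous fun x : S3 => bubble P t x ^ 2 *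
      ⟪(x : EuclideanSpace ℝ (Fin 4)), (Q : EuclideanSpace ℝ (Fin 4))⟫ := by fun_prop
  have hG : Continuous fun x : S3 => bubble P t x ^ 2 *
      ⟪(x : EuclideanSpace ℝ (Fin 4)), (P : EuclideanSpace ℝ (Fin 4))⟫ := by fun_prop
  have h1 := integral_map hmp.aemeasurable (f := fun x : S3 => bubble P t x ^ 2 *
      ⟪(x : EuclideanSpace ℝ (Fin 4)), (Q : EuclideanSpace ℝ (Fin 4))⟫)
      hF.aestronglyMeasurable
  rw [hmp.map_eq] at h1
  have h2 : ∫ x : S3, bubble P t (sphereMap L x) ^ 2 *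
      ⟪(sphereMap L x : EuclideanSpace ℝ (Fin 4)), (Q : EuclideanSpace ℝ (Fin 4))⟫ ∂μS3 =
      ∫ x : S3, (2 * ⟪(P : EuclideanSpace ℝ (Fin 4)), (Q : EuclideanSpace ℝ (Fin 4))⟫ *
        (bubble P t x ^ 2 *
          ⟪(x : EuclideanSpace ℝ (Fin 4)), (P : EuclideanSpace ℝ (Fin 4))⟫) -
        bubble P t x ^ 2 *
          ⟪(x : EuclideanSpace ℝ (Fin 4)), (Q : EuclideanSpace ℝ (Fin 4))⟫) ∂μS3 := by
    refine integral_congr_ae (.of_forall fun x => ?_)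
    simp only [hbub, hin]
    ring
  rw [h2, integral_sub ((integrable_of_continuous_sphere hG).const_mul _)
    (integrable_of_continuous_sphere hF), integral_const_mul] at h1
  linarith

lemma bubble_mul_one_sub_inner_le (P : S3) {t : ℝ} (ht : 2 ≤ t) (x : S3) :
    bubble P t x * (1 - ⟪(x : EuclideanSpace ℝ (Fin 4)), (P : EuclideanSpace ℝ (Fin 4))⟫) ≤
      3 * t⁻¹ := by
  have hu := sphere_inner_le_one x P
  have hD := bubble_denom_pos (by linarith : 1 < t) hu
  rw [bubble, div_mul_eq_mul_div, ← div_eq_mul_inv, div_le_div_iff₀ hD (by linarith)]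
  have := mul_nonneg (show 0 ≤ t ^ 2 - 3 by nlinarith) (sub_nonneg.2 hu)
  nlinarith

lemma sphere_half_one_sub_inner_le (x P Q : S3) :
    (1 - ⟪(P : EuclideanSpace ℝ (Fin 4)), (Q : EuclideanSpace ℝ (Fin 4))⟫) / 2 ≤
      (1 - ⟪(x : EuclideanSpace ℝ (Fin 4)), (P : EuclideanSpace ℝ (Fin 4))⟫) +
      (1 - ⟪(x : EuclideanSpace ℝ (Fin 4)), (Q : EuclideanSpace ℝ (Fin 4))⟫) := by
  have h := real_inner_self_nonneg
    (x := (P : EuclideanSpace ℝ (Fin 4)) + (Q : EuclideanSpace ℝ (Fin 4)) -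
      (2 : ℝ) • (x : EuclideanSpace ℝ (Fin 4)))
  have hP : ⟪(P : EuclideanSpace ℝ (Fin 4)), (P : EuclideanSpace ℝ (Fin 4))⟫ = 1 := by simp
  have hQ : ⟪(Q : EuclideanSpace ℝ (Fin 4)), (Q : EuclideanSpace ℝ (Fin 4))⟫ = 1 := by simp
  have hx : ⟪(x : EuclideanSpace ℝ (Fin 4)), (x : EuclideanSpace ℝ (Fin 4))⟫ = 1 := by simp
  simp only [inner_sub_left, inner_sub_right, inner_add_left, inner_add_right,
    real_inner_smul_left, real_inner_smul_right, hP, hQ, hx,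
    real_inner_comm (x : EuclideanSpace ℝ (Fin 4)) (P : EuclideanSpace ℝ (Fin 4)),
    real_inner_comm (x : EuclideanSpace ℝ (Fin 4)) (Q : EuclideanSpace ℝ (Fin 4)),
    real_inner_comm (P : EuclideanSpace ℝ (Fin 4)) (Q : EuclideanSpace ℝ (Fin 4))] at h
  linarith

lemma sphere_inner_sub_sq_le (x P Q : S3) :
    (⟪(x : EuclideanSpace ℝ (Fin 4)), (Q : EuclideanSpace ℝ (Fin 4))⟫ -
      ⟪(P : EuclideanSpace ℝ (Fin 4)), (Q : EuclideanSpace ℝ (Fin 4))⟫) ^ 2 ≤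
      2 * (1 - ⟪(x : EuclideanSpace ℝ (Fin 4)), (P : EuclideanSpace ℝ (Fin 4))⟫) := by
  rw [← inner_sub_left]
  have h := abs_real_inner_le_norm ((x : EuclideanSpace ℝ (Fin 4)) - P) Q
  have hn := norm_sub_sq_real (x : EuclideanSpace ℝ (Fin 4)) P
  simp only [norm_eq_of_mem_sphere, mul_one] at h hn
  rw [← sq_abs]
  nlinarith [abs_nonneg ⟪(x : EuclideanSpace ℝ (Fin 4)) - P, (Q : EuclideanSpace ℝ (Fin 4))⟫]

lemma bubble_mul_bubble_le {g : ℝ} (hg : 0 < g) {P Q : S3}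
    (hPQ : g ≤ 1 - ⟪(P : EuclideanSpace ℝ (Fin 4)), (Q : EuclideanSpace ℝ (Fin 4))⟫)
    {t s : ℝ} (ht : 2 ≤ t) (hs : 2 ≤ s) (x : S3) :
    bubble P t x * bubble Q s x ≤
      2 / g * (3 * t⁻¹ * bubble Q s x + 3 * s⁻¹ * bubble P t x) := by
  have h1 := bubble_mul_one_sub_inner_le P ht x
  have h2 := bubble_mul_one_sub_inner_le Q hs x
  have hp := bubble_pos P (by linarith : 1 < t) x
  have hq := bubble_pos Q (by linarith : 1 < s) x
  have hsum := sphere_half_one_sub_inner_le x P Q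
  rw [div_mul_eq_mul_div, le_div_iff₀ hg]
  set u := 1 - ⟪(x : EuclideanSpace ℝ (Fin 4)), (P : EuclideanSpace ℝ (Fin 4))⟫
  set v := 1 - ⟪(x : EuclideanSpace ℝ (Fin 4)), (Q : EuclideanSpace ℝ (Fin 4))⟫
  calc bubble P t x * bubble Q s x * g ≤ bubble P t x * bubble Q s x * (2 * (u + v)) := by
        gcongr
        linarith
    _ = 2 * (bubble P t x * u * bubble Q s x + bubble Q s x * v * bubble P t x) := by ring
    _ ≤ _ := by gcongr

lemma integral_bubble_mul_bubble_le {g : ℝ} (hg : 0 < g) {P Q : S3}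
    (hPQ : g ≤ 1 - ⟪(P : EuclideanSpace ℝ (Fin 4)), (Q : EuclideanSpace ℝ (Fin 4))⟫)
    {t s : ℝ} (ht : 2 ≤ t) (hs : 2 ≤ s) :
    ∫ x, bubble P t x * bubble Q s x ∂μS3 ≤ 288 * π ^ 2 / g * (t⁻¹ * s⁻¹) := by
  have hp := continuous_bubble P (by linarith : 1 < t)
  have hq := continuous_bubble Q (by linarith : 1 < s)
  have ht0 : 0 < t := by linarith
  have hs0 : 0 < s := by linarith
  calc _ ≤ ∫ x, 2 / g * (3 * t⁻¹ * bubble Q s x + 3 * s⁻¹ * bubble P t x) ∂μS3 :=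
        integral_mono (integrable_of_continuous_sphere (by fun_prop))
          (integrable_of_continuous_sphere (by fun_prop)) (bubble_mul_bubble_le hg hPQ ht hs)
    _ = 2 / g * (3 * t⁻¹ * ∫ x, bubble Q s x ∂μS3 + 3 * s⁻¹ * ∫ x, bubble P t x ∂μS3) := by
        rw [integral_const_mul, integral_add (integrable_of_continuous_sphere (by fun_prop))
          (integrable_of_continuous_sphere (by fun_prop)), integral_const_mul, integral_const_mul]
    _ ≤ 2 / g * (3 * t⁻¹ * (24 * π ^ 2 * s⁻¹) + 3 * s⁻¹ * (24 * π ^ 2 * t⁻¹)) := by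
        gcongr
        · exact integral_bubble_le Q hs
        · exact integral_bubble_le P ht
    _ = _ := by ring

lemma abs_integral_bubble_sq_mul_inner_sub_le (P Q : S3) {t : ℝ} (ht : 2 ≤ t) :
    |∫ x : S3, bubble P t x ^ 2 *
        (⟪(x : EuclideanSpace ℝ (Fin 4)), (Q : EuclideanSpace ℝ (Fin 4))⟫ -
          ⟪(P : EuclideanSpace ℝ (Fin 4)), (Q : EuclideanSpace ℝ (Fin 4))⟫) ∂μS3| ≤
      72 * π ^ 2 * (t⁻¹) ^ 2 := by
  have ht1 : 1 < t := by linarith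
  have hp := continuous_bubble P ht1
  set c := ⟪(P : EuclideanSpace ℝ (Fin 4)), (Q : EuclideanSpace ℝ (Fin 4))⟫ with hc
  have hc1 : |c| ≤ 1 := by
    simpa using abs_real_inner_le_norm (P : EuclideanSpace ℝ (Fin 4)) Q
  have heq : ∫ x : S3, bubble P t x ^ 2 *
        (⟪(x : EuclideanSpace ℝ (Fin 4)), (Q : EuclideanSpace ℝ (Fin 4))⟫ - c) ∂μS3 =
      -c * ∫ x : S3, bubble P t x ^ 2 *
        (1 - ⟪(x : EuclideanSpace ℝ (Fin 4)), (P : EuclideanSpace ℝ (Fin 4))⟫) ∂μS3 := by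
    simp only [mul_sub, mul_one]
    rw [integral_sub (integrable_of_continuous_sphere (by fun_prop))
      (integrable_of_continuous_sphere (by fun_prop)),
      integral_sub (integrable_of_continuous_sphere (by fun_prop))
      (integrable_of_continuous_sphere (by fun_prop)), integral_mul_const,
      integral_bubble_sq_mul_inner P Q ht1]
    ring
  have hnonneg : 0 ≤ ∫ x : S3, bubble P t x ^ 2 *
        (1 - ⟪(x : EuclideanSpace ℝ (Fin 4)), (P : EuclideanSpace ℝ (Fin 4))⟫) ∂μS3 :=
    integral_nonneg fun x => mul_nonneg (sq_nonneg _) (sub_nonneg.2 (sphere_inner_le_one x P))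
  have hle : ∫ x : S3, bubble P t x ^ 2 *
        (1 - ⟪(x : EuclideanSpace ℝ (Fin 4)), (P : EuclideanSpace ℝ (Fin 4))⟫) ∂μS3 ≤
      72 * π ^ 2 * (t⁻¹) ^ 2 := by
    calc _ ≤ ∫ x, 3 * t⁻¹ * bubble P t x ∂μS3 := by
          refine integral_mono (integrable_of_continuous_sphere (by fun_prop))
            (integrable_of_continuous_sphere (by fun_prop)) fun x => ?_
          have := mul_le_mul_of_nonneg_right (bubble_mul_one_sub_inner_le P ht x)
            (bubble_pos P ht1 x).le
          dsimp only
          linarith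
      _ = 3 * t⁻¹ * ∫ x, bubble P t x ∂μS3 := integral_const_mul _ _
      _ ≤ 3 * t⁻¹ * (24 * π ^ 2 * t⁻¹) := by
          gcongr
          exact integral_bubble_le P ht
      _ = _ := by ring
  rw [heq, abs_mul, abs_neg, abs_of_nonneg hnonneg]
  exact (mul_le_of_le_one_left hnonneg hc1).trans hle

lemma integral_bubble_sq_mul_inner_sub_sq_mul_bubble_le {g : ℝ} (hg : 0 < g) {P Q : S3}
    (hPQ : g ≤ 1 - ⟪(P : EuclideanSpace ℝ (Fin 4)), (Q : EuclideanSpace ℝ (Fin 4))⟫)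
    {t s : ℝ} (ht : 2 ≤ t) (hs : 2 ≤ s) :
    ∫ x : S3, bubble P t x ^ 2 *
        (⟪(x : EuclideanSpace ℝ (Fin 4)), (Q : EuclideanSpace ℝ (Fin 4))⟫ -
          ⟪(P : EuclideanSpace ℝ (Fin 4)), (Q : EuclideanSpace ℝ (Fin 4))⟫) ^ 2 *
        bubble Q s x ∂μS3 ≤
      1728 * π ^ 2 / g * ((t⁻¹) ^ 2 * s⁻¹) := by
  have hp := continuous_bubble P (by linarith : 1 < t)
  have hq := continuous_bubble Q (by linarith : 1 < s)
  have ht0 : 0 < t := by linarith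
  calc _ ≤ ∫ x, 6 * t⁻¹ * (bubble P t x * bubble Q s x) ∂μS3 := by
        refine integral_mono (integrable_of_continuous_sphere (by fun_prop))
          (integrable_of_continuous_sphere (by fun_prop)) fun x => ?_
        have hp0 := bubble_pos P (by linarith : 1 < t) x
        have hq0 := bubble_pos Q (by linarith : 1 < s) x
        calc _ ≤ bubble P t x ^ 2 *
              (2 * (1 - ⟪(x : EuclideanSpace ℝ (Fin 4)), (P : EuclideanSpace ℝ (Fin 4))⟫)) *
              bubble Q s x := by
              gcongr
              exact sphere_inner_sub_sq_le x P Q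
          _ = 2 * (bubble P t x *
              (1 - ⟪(x : EuclideanSpace ℝ (Fin 4)), (P : EuclideanSpace ℝ (Fin 4))⟫)) *
              (bubble P t x * bubble Q s x) := by ring
          _ ≤ 2 * (3 * t⁻¹) * (bubble P t x * bubble Q s x) := by
              have := bubble_mul_one_sub_inner_le P ht x
              exact mul_le_mul_of_nonneg_right (by linarith) (by positivity)
          _ = _ := by ring
    _ = 6 * t⁻¹ * ∫ x, bubble P t x * bubble Q s x ∂μS3 := integral_const_mul _ _
    _ ≤ 6 * t⁻¹ * (288 * π ^ 2 / g * (t⁻¹ * s⁻¹)) := by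
        gcongr
        exact integral_bubble_mul_bubble_le hg hPQ ht hs
    _ = _ := by ring

lemma bubble_expansion (P Q : S3) {s : ℝ} (hs : 1 < s) (x : S3) {β k D z : ℝ}
    (hβ : β = 1 - ⟪(P : EuclideanSpace ℝ (Fin 4)), (Q : EuclideanSpace ℝ (Fin 4))⟫)
    (hk : k = (s ^ 2 - 1) / 2) (hD : D = 1 + k * β) (hD0 : D ≠ 0)
    (hz : z = ⟪(x : EuclideanSpace ℝ (Fin 4)), (Q : EuclideanSpace ℝ (Fin 4))⟫ -
      ⟪(P : EuclideanSpace ℝ (Fin 4)), (Q : EuclideanSpace ℝ (Fin 4))⟫) :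
    bubble Q s x = s / D + s * k / D ^ 2 * z + k ^ 2 / D ^ 2 * (z ^ 2 * bubble Q s x) := by
  have hX := bubble_denom_pos hs (sphere_inner_le_one x Q)
  have hXD : 1 + (s ^ 2 - 1) / 2 *
      (1 - ⟪(x : EuclideanSpace ℝ (Fin 4)), (Q : EuclideanSpace ℝ (Fin 4))⟫) = D - k * z := by
    rw [hD, hk, hβ, hz]
    ring
  rw [bubble, hXD]
  rw [hXD] at hX
  have := hX.ne'
  field_simp
  ring

lemma integral_bubble_sq_mul_bubble_eq (P Q : S3) {t s : ℝ} (ht : 1 < t) (hs : 1 < s)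
    {β k D : ℝ}
    (hβ : β = 1 - ⟪(P : EuclideanSpace ℝ (Fin 4)), (Q : EuclideanSpace ℝ (Fin 4))⟫)
    (hk : k = (s ^ 2 - 1) / 2) (hD : D = 1 + k * β) (hD0 : D ≠ 0) :
    ∫ x, bubble P t x ^ 2 * bubble Q s x ∂μS3 =
      s / D * (8 * π ^ 2 * (t / (t + 1) ^ 2)) +
      s * k / D ^ 2 * ∫ x : S3, bubble P t x ^ 2 *
        (⟪(x : EuclideanSpace ℝ (Fin 4)), (Q : EuclideanSpace ℝ (Fin 4))⟫ -
          ⟪(P : EuclideanSpace ℝ (Fin 4)), (Q : EuclideanSpace ℝ (Fin 4))⟫) ∂μS3 +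
      k ^ 2 / D ^ 2 * ∫ x : S3, bubble P t x ^ 2 *
        (⟪(x : EuclideanSpace ℝ (Fin 4)), (Q : EuclideanSpace ℝ (Fin 4))⟫ -
          ⟪(P : EuclideanSpace ℝ (Fin 4)), (Q : EuclideanSpace ℝ (Fin 4))⟫) ^ 2 *
        bubble Q s x ∂μS3 := by
  have hp := continuous_bubble P ht
  have hq := continuous_bubble Q hs
  rw [← integral_bubble_sq P ht, ← integral_const_mul, ← integral_const_mul,
    ← integral_const_mul, ← integral_add (integrable_of_continuous_sphere (by fun_prop))
      (integrable_of_continuous_sphere (by fun_prop)),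
    ← integral_add (integrable_of_continuous_sphere (by fun_prop))
      (integrable_of_continuous_sphere (by fun_prop))]
  refine integral_congr_ae (.of_forall fun x => ?_)
  have h := congrArg (fun b => bubble P t x ^ 2 * b)
    (bubble_expansion P Q hs x hβ hk hD hD0 rfl)
  dsimp only at h ⊢
  rw [h]
  ring

lemma abs_bubble_leading_sub_le {g β k D s : ℝ} (hg : 0 < g) (hgβ : g ≤ β) (hβ2 : β ≤ 2)
    (hs : 2 ≤ s) (hk : k = (s ^ 2 - 1) / 2) (hD : D = 1 + k * β) :
    |s / D - 2 * s⁻¹ / β| ≤ 6 / g ^ 2 * s⁻¹ ^ 3 := by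
  have hs0 : 0 < s := by linarith
  have hβ : 0 < β := hg.trans_le hgβ
  have hks : s ^ 2 / 3 ≤ k := by nlinarith
  have hD1 : s ^ 2 / 3 * g ≤ D := by
    have : s ^ 2 / 3 * g ≤ k * β := mul_le_mul hks hgβ hg.le ((by positivity : 0 ≤ s ^ 2 / 3).trans hks)
    linarith
  have hD0 : 0 < D := (by positivity : 0 < s ^ 2 / 3 * g).trans_le hD1
  have heq : s / D - 2 * s⁻¹ / β = -((2 - β) / (β * s * D)) := by
    field_simp
    rw [hD, hk]
    ring
  rw [heq, abs_neg, abs_of_nonneg (div_nonneg (by linarith) (by positivity))]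
  calc (2 - β) / (β * s * D) ≤ 2 / (g * s * (s ^ 2 / 3 * g)) := by
        gcongr
        linarith
    _ = _ := by
        field_simp
        norm_num

lemma abs_div_add_one_sq_sub_inv_le {t : ℝ} (ht : 0 < t) :
    |t / (t + 1) ^ 2 - t⁻¹| ≤ 2 * t⁻¹ ^ 2 := by
  have heq : t / (t + 1) ^ 2 - t⁻¹ = -((2 * t + 1) / (t * (t + 1) ^ 2)) := by
    field_simp
    ring
  rw [heq, abs_neg, abs_of_nonneg (by positivity), inv_pow, ← div_eq_mul_inv,
    div_le_div_iff₀ (by positivity) (by positivity)]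
  nlinarith [pow_pos ht 2]

/-- Quantitative interaction estimate for two bubbles whose centres satisfy
`⟪P, Q⟫ ≤ 1 - g`. -/
lemma abs_integral_bubble_sq_mul_bubble_sub_le {g : ℝ} (hg : 0 < g) {P Q : S3}
    (hPQ : g ≤ 1 - ⟪(P : EuclideanSpace ℝ (Fin 4)), (Q : EuclideanSpace ℝ (Fin 4))⟫)
    {t s y : ℝ} (ht : 2 ≤ t) (hs : 2 ≤ s) (hty : t⁻¹ ≤ y) (hsy : s⁻¹ ≤ y) :
    |(∫ x, bubble P t x ^ 2 * bubble Q s x ∂μS3) - 16 * π ^ 2 * (green P Q / (t * s))| ≤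
      π ^ 2 * (264 / g ^ 2 + 32 / g + 1728 / g ^ 3) * y ^ 3 := by
  have ht0 : 0 < t := by linarith
  have hs0 : 0 < s := by linarith
  have hy0 : 0 ≤ y := (by positivity : 0 ≤ t⁻¹).trans hty
  obtain ⟨β, hβ⟩ : ∃ β, β = 1 - ⟪(P : EuclideanSpace ℝ (Fin 4)),
    (Q : EuclideanSpace ℝ (Fin 4))⟫ := ⟨_, rfl⟩
  obtain ⟨k, hk⟩ : ∃ k, k = (s ^ 2 - 1) / 2 := ⟨_, rfl⟩
  obtain ⟨D, hD⟩ : ∃ D, D = 1 + k * β := ⟨_, rfl⟩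
  have hgβ : g ≤ β := hβ ▸ hPQ
  have hβ0 : 0 < β := hg.trans_le hgβ
  have hβ2 : β ≤ 2 := by
    have := neg_le_of_abs_le (abs_real_inner_le_norm (P : EuclideanSpace ℝ (Fin 4)) Q)
    simp only [norm_eq_of_mem_sphere, mul_one] at this
    linarith
  have hk0 : 0 < k := by nlinarith
  have hD1 : k * g ≤ D := by nlinarith
  have hD0 : 0 < D := (mul_pos hk0 hg).trans_le hD1
  have hks : s / k ≤ 3 * s⁻¹ := by
    rw [← div_eq_mul_inv, div_le_div_iff₀ hk0 hs0]
    nlinarith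
  have hc1 : s * k / D ^ 2 ≤ 3 / g ^ 2 * s⁻¹ := by
    calc s * k / D ^ 2 ≤ s * k / (k * g) ^ 2 := by gcongr
      _ = s / k * (1 / g ^ 2) := by field_simp
      _ ≤ 3 * s⁻¹ * (1 / g ^ 2) := by gcongr
      _ = _ := by ring
  have hc2 : k ^ 2 / D ^ 2 ≤ 1 / g ^ 2 := by
    calc k ^ 2 / D ^ 2 ≤ k ^ 2 / (k * g) ^ 2 := by gcongr
      _ = _ := by field_simp
  have hI := integral_bubble_sq_mul_bubble_eq P Q (by linarith : 1 < t) (by linarith : 1 < s)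
    hβ hk hD hD0.ne'
  have hJ := abs_integral_bubble_sq_mul_inner_sub_le P Q ht
  have hK := integral_bubble_sq_mul_inner_sub_sq_mul_bubble_le hg hPQ ht hs
  have hK0 : 0 ≤ ∫ x : S3, bubble P t x ^ 2 *
        (⟪(x : EuclideanSpace ℝ (Fin 4)), (Q : EuclideanSpace ℝ (Fin 4))⟫ -
          ⟪(P : EuclideanSpace ℝ (Fin 4)), (Q : EuclideanSpace ℝ (Fin 4))⟫) ^ 2 *
        bubble Q s x ∂μS3 := integral_nonneg fun x =>
    mul_nonneg (by positivity) (bubble_pos Q (by linarith) x).le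
  set J := ∫ x : S3, bubble P t x ^ 2 *
        (⟪(x : EuclideanSpace ℝ (Fin 4)), (Q : EuclideanSpace ℝ (Fin 4))⟫ -
          ⟪(P : EuclideanSpace ℝ (Fin 4)), (Q : EuclideanSpace ℝ (Fin 4))⟫) ∂μS3
  set K := ∫ x : S3, bubble P t x ^ 2 *
        (⟪(x : EuclideanSpace ℝ (Fin 4)), (Q : EuclideanSpace ℝ (Fin 4))⟫ -
          ⟪(P : EuclideanSpace ℝ (Fin 4)), (Q : EuclideanSpace ℝ (Fin 4))⟫) ^ 2 *
        bubble Q s x ∂μS3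
  have hsplit : (∫ x, bubble P t x ^ 2 * bubble Q s x ∂μS3) -
      16 * π ^ 2 * (green P Q / (t * s)) =
      8 * π ^ 2 * (t / (t + 1) ^ 2) * (s / D - 2 * s⁻¹ / β) +
      16 * π ^ 2 / β * s⁻¹ * (t / (t + 1) ^ 2 - t⁻¹) +
      s * k / D ^ 2 * J + k ^ 2 / D ^ 2 * K := by
    rw [hI, green, ← hβ]
    field_simp
    ring
  have htt : t / (t + 1) ^ 2 ≤ 1 := by
    rw [div_le_one (by positivity)]
    nlinarith
  have hE1 : |8 * π ^ 2 * (t / (t + 1) ^ 2) * (s / D - 2 * s⁻¹ / β)| ≤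
      π ^ 2 * (48 / g ^ 2) * y ^ 3 := by
    rw [abs_mul, abs_of_nonneg (by positivity)]
    calc _ ≤ 8 * π ^ 2 * 1 * (6 / g ^ 2 * s⁻¹ ^ 3) := by
          gcongr
          exact abs_bubble_leading_sub_le hg hgβ hβ2 hs hk hD
      _ ≤ 8 * π ^ 2 * 1 * (6 / g ^ 2 * y ^ 3) := by gcongr
      _ = _ := by ring
  have hE2 : |16 * π ^ 2 / β * s⁻¹ * (t / (t + 1) ^ 2 - t⁻¹)| ≤
      π ^ 2 * (32 / g) * y ^ 3 := by
    rw [abs_mul, abs_of_nonneg (by positivity)]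
    calc _ ≤ 16 * π ^ 2 / g * s⁻¹ * (2 * t⁻¹ ^ 2) := by
          gcongr
          exact abs_div_add_one_sq_sub_inv_le ht0
      _ ≤ 16 * π ^ 2 / g * y * (2 * y ^ 2) := by gcongr
      _ = _ := by ring
  have hE3 : |s * k / D ^ 2 * J| ≤ π ^ 2 * (216 / g ^ 2) * y ^ 3 := by
    rw [abs_mul, abs_of_nonneg (by positivity)]
    calc _ ≤ 3 / g ^ 2 * s⁻¹ * (72 * π ^ 2 * t⁻¹ ^ 2) := by gcongr
      _ ≤ 3 / g ^ 2 * y * (72 * π ^ 2 * y ^ 2) := by gcongr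
      _ = _ := by ring
  have hE4 : |k ^ 2 / D ^ 2 * K| ≤ π ^ 2 * (1728 / g ^ 3) * y ^ 3 := by
    rw [abs_mul, abs_of_nonneg (by positivity), abs_of_nonneg hK0]
    calc _ ≤ 1 / g ^ 2 * (1728 * π ^ 2 / g * (t⁻¹ ^ 2 * s⁻¹)) := by gcongr
      _ ≤ 1 / g ^ 2 * (1728 * π ^ 2 / g * (y ^ 2 * y)) := by gcongr
      _ = _ := by
        field_simp
  rw [hsplit]
  refine ((abs_add_le _ _).trans (add_le_add ((abs_add_le _ _).trans (add_le_add
    ((abs_add_le _ _).trans (add_le_add hE1 hE2)) hE3)) hE4)).trans_eq ?_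
  ring

theorem stmt10 (ε₀ A : ℝ) (hε₀ : ε₀ ∈ Set.Ioo 0 π) (hA : 1 ≤ A) :
    ∃ C > 0, ∃ τ₀ ∈ Set.Ioo (0 : ℝ) 1, ∀ τ ∈ Set.Ioo (0 : ℝ) τ₀, ∀ t₁ t₂ : ℝ,
      A⁻¹ * τ ^ (-(1 : ℝ) / 2) < t₁ → t₁ < A * τ ^ (-(1 : ℝ) / 2) →
      A⁻¹ * τ ^ (-(1 : ℝ) / 2) < t₂ → t₂ < A * τ ^ (-(1 : ℝ) / 2) →
      ∀ P₁ P₂ : S3, ε₀ ≤ geoDist P₁ P₂ →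
      |(∫ x, (bubble P₁ t₁ x) ^ 2 * bubble P₂ t₂ x ∂μS3) -
          16 * π ^ 2 * (green P₁ P₂ / (t₁ * t₂))| ≤ C * τ ^ ((3 : ℝ) / 2) := by
  have hA0 : 0 < A := by linarith
  obtain ⟨g, hg_def⟩ : ∃ g, g = 1 - cos ε₀ := ⟨_, rfl⟩
  have hg : 0 < g := by
    have := cos_lt_cos_of_nonneg_of_le_pi le_rfl hε₀.2.le hε₀.1
    rw [cos_zero] at this
    linarith
  refine ⟨π ^ 2 * (264 / g ^ 2 + 32 / g + 1728 / g ^ 3) * A ^ 3, by positivity,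
    1 / (4 * A ^ 2), ⟨by positivity, ?_⟩, ?_⟩
  · rw [div_lt_one (by positivity)]
    nlinarith
  intro τ hτ t₁ t₂ h₁ _ h₂ _ P₁ P₂ hd
  have hτ0 : 0 < τ := hτ.1
  have hrpow : τ ^ (-(1 : ℝ) / 2) = (√τ)⁻¹ := by
    rw [neg_div, rpow_neg hτ0.le, sqrt_eq_rpow]
  have hpow : τ ^ ((3 : ℝ) / 2) = √τ ^ 3 := by
    rw [sqrt_eq_rpow, ← rpow_natCast, ← rpow_mul hτ0.le]
    norm_num
  have hsq : 0 < √τ := sqrt_pos.2 hτ0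
  have hsmall : A * √τ ≤ 1 / 2 := by
    refine abs_le_of_sq_le_sq' ?_ (by norm_num) |>.2
    rw [mul_pow, sq_sqrt hτ0.le]
    have := hτ.2
    rw [lt_div_iff₀ (by positivity)] at this
    linarith
  rw [hrpow, ← mul_inv] at h₁ h₂
  have hy : 0 < A * √τ := by positivity
  have htwo : 2 ≤ (A * √τ)⁻¹ := by
    rw [le_inv_comm₀ (by norm_num) hy]
    linarith
  have hinner : g ≤ 1 - ⟪(P₁ : EuclideanSpace ℝ (Fin 4)), (P₂ : EuclideanSpace ℝ (Fin 4))⟫ := by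
    have habs := abs_le.1 (abs_real_inner_le_norm (P₁ : EuclideanSpace ℝ (Fin 4)) P₂)
    simp only [norm_eq_of_mem_sphere, mul_one] at habs
    have := cos_le_cos_of_nonneg_of_le_pi hε₀.1.le (arccos_le_pi _) hd
    rw [cos_arccos habs.1 habs.2] at this
    linarith
  have := abs_integral_bubble_sq_mul_bubble_sub_le hg hinner (y := A * √τ)
    (htwo.trans h₁.le) (htwo.trans h₂.le) (inv_le_of_inv_le₀ hy h₁.le)
    (inv_le_of_inv_le₀ hy h₂.le)
  rw [hpow]
  refine this.trans_eq ?_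
  ring
end
end

section
/- For every ε₀ ∈ (0, π) and every A ≥ 1 there exist constants C > 0 and τ₀ ∈ (0,1), depending only on ε₀ and A, such that for all τ ∈ (0, τ₀), all t₁, t₂ with A⁻¹ τ^{−1/2} < t₁, t₂ < A τ^{−1/2}, and all P₁, P₂ ∈ S³ with geodesic distance d(P₁,P₂) ≥ ε₀, the derivative at s = t₁ of the function s ↦ ∫_{S³} δ_{P₁,s}(x)² δ_{P₂,t₂}(x) dx satisfies | (d/ds)|_{s=t₁} ∫_{S³} δ_{P₁,s}² δ_{P₂,t₂} dx + 16π² · G_{P₁}(P₂)/(t₁² t₂) | ≤ C τ². -/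
open MeasureTheory Real Set Metric
open scoped RealInnerProductSpace

noncomputable section

open scoped ENNReal

theorem lintegral_eq_lintegral_toSphere {E : Type*} [NormedAddCommGroup E] [NormedSpace ℝ E]
    [MeasurableSpace E] [BorelSpace E] [FiniteDimensional ℝ E] [Nontrivial E]
    (μ : Measure E) [μ.IsAddHaarMeasure] {F : E → ℝ≥0∞} (hF : Measurable F) :
    ∫⁻ x, F x ∂μ = ∫⁻ ω, (∫⁻ r in Ioi (0 : ℝ),
      ENNReal.ofReal (r ^ (Module.finrank ℝ E - 1)) * F (r • (ω : E))) ∂μ.toSphere := by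
  have hm : Measurable fun p : sphere (0 : E) 1 × Ioi (0 : ℝ) ↦ F ((p.2 : ℝ) • (p.1 : E)) := by
    fun_prop
  calc
    ∫⁻ x, F x ∂μ = ∫⁻ x : ({(0)}ᶜ : Set E), F x ∂(μ.comap (↑)) := by
      rw [lintegral_subtype_comap (measurableSet_singleton _).compl, restrict_compl_singleton]
    _ = ∫⁻ p, F ((p.2 : ℝ) • (p.1 : E)) ∂μ.toSphere.prod (.volumeIoiPow
        (Module.finrank ℝ E - 1)) := by
      rw [← μ.measurePreserving_homeomorphUnitSphereProd.lintegral_comp hm]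
      refine lintegral_congr fun x ↦ ?_
      congr 1
      have : ‖(x : E)‖ ≠ 0 := norm_ne_zero_iff.2 x.2
      simp [smul_smul, this]
    _ = _ := by
      rw [lintegral_prod _ hm.aemeasurable]
      refine lintegral_congr fun ω ↦ ?_
      rw [Measure.volumeIoiPow, lintegral_withDensity_eq_lintegral_mul _ (by fun_prop)
        (by fun_prop), ← lintegral_subtype_comap measurableSet_Ioi]
      rfl

theorem lintegral_fun_norm {E : Type*} [NormedAddCommGroup E] [NormedSpace ℝ E]
    [MeasurableSpace E] [BorelSpace E] [FiniteDimensional ℝ E] [Nontrivial E]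
    (μ : Measure E) [μ.IsAddHaarMeasure] {F : ℝ → ℝ≥0∞} (hF : Measurable F) :
    ∫⁻ x, F ‖x‖ ∂μ = μ.toSphere univ * ∫⁻ r in Ioi (0 : ℝ),
      ENNReal.ofReal (r ^ (Module.finrank ℝ E - 1)) * F r := by
  rw [lintegral_eq_lintegral_toSphere μ (by fun_prop), mul_comm, ← lintegral_const]
  refine lintegral_congr fun ω ↦ setLIntegral_congr_fun measurableSet_Ioi fun r hr ↦ ?_
  simp [norm_smul, abs_of_pos (mem_Ioi.1 hr)]

theorem toSphere_volume_univ_three :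
    (volume : Measure (EuclideanSpace ℝ (Fin 3))).toSphere univ = ENNReal.ofReal (4 * π) := by
  rw [Measure.toSphere_apply_univ, EuclideanSpace.volume_ball_fin_three]
  simp only [finrank_euclideanSpace, Fintype.card_fin, ENNReal.ofReal_one, one_pow, one_mul]
  rw [← ENNReal.ofReal_natCast, ← ENNReal.ofReal_mul (by positivity)]
  congr 1
  push_cast
  ring

theorem lintegral_inner_norm_four {v : EuclideanSpace ℝ (Fin 4)} (hv : ‖v‖ = 1)
    {g : ℝ × ℝ → ℝ≥0∞} (hg : Measurable g) :
    ∫⁻ x : EuclideanSpace ℝ (Fin 4), g (⟪x, v⟫, ‖x‖) =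
      ∫⁻ s : ℝ, ∫⁻ y : EuclideanSpace ℝ (Fin 3), g (s, √(s ^ 2 + ‖y‖ ^ 2)) := by
  obtain ⟨b, hb⟩ := Orthonormal.exists_orthonormalBasis_extension_of_card_eq (𝕜 := ℝ)
    (E := EuclideanSpace ℝ (Fin 4)) (ι := Fin 4) (by simp) (v := fun _ ↦ v) (s := {0})
    ⟨fun i ↦ by simpa using hv, fun i j hij ↦ (hij (Subsingleton.elim i j)).elim⟩
  have hb0 : b 0 = v := hb 0 rfl
  have e1 := (EuclideanSpace.volume_preserving_symm_measurableEquiv_toLp (Fin 4)).comp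
    b.measurePreserving_repr
  have e2 := (volume_preserving_piFinSuccAbove (fun _ : Fin 4 => ℝ) 0).comp e1
  have e3 := (((MeasurePreserving.id (volume : Measure ℝ)).prod
    (EuclideanSpace.volume_preserving_symm_measurableEquiv_toLp (Fin 3)).symm)).comp e2
  have hm : Measurable fun p : ℝ × EuclideanSpace ℝ (Fin 3) ↦ g (p.1, √(p.1 ^ 2 + ‖p.2‖ ^ 2)) := by
    fun_prop
  have := e3.lintegral_comp hm
  rw [lintegral_prod _ hm.aemeasurable] at this
  rw [← this]
  refine lintegral_congr fun x ↦ ?_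
  congr 2
  · simp [← hb0, b.repr_apply_apply, real_inner_comm]
  · rw [← b.repr.norm_map, EuclideanSpace.norm_eq, EuclideanSpace.norm_sq_eq, Fin.sum_univ_succ]
    simp
    rfl

theorem lintegral_norm_inner_polar {v : EuclideanSpace ℝ (Fin 4)} (hv : ‖v‖ = 1)
    {g : ℝ × ℝ → ℝ≥0∞} (hg : Measurable g) :
    ∫⁻ x : EuclideanSpace ℝ (Fin 4), g (⟪x, v⟫, ‖x‖) =
      ENNReal.ofReal (4 * π) * ∫⁻ r in Ioi (0 : ℝ), ∫⁻ θ in Ioo 0 π,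
        ENNReal.ofReal (r ^ 3) * (ENNReal.ofReal (sin θ ^ 2) * g (r * cos θ, r)) := by
  rw [lintegral_inner_norm_four hv hg]
  have h1 (s : ℝ) : ∫⁻ y : EuclideanSpace ℝ (Fin 3), g (s, √(s ^ 2 + ‖y‖ ^ 2)) =
      ENNReal.ofReal (4 * π) * ∫⁻ r : ℝ, (Ioi (0 : ℝ)).indicator
        (fun r ↦ ENNReal.ofReal (r ^ 2) * g (s, √(s ^ 2 + r ^ 2))) r := by
    rw [lintegral_fun_norm volume (F := fun r ↦ g (s, √(s ^ 2 + r ^ 2))) (by fun_prop),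
      toSphere_volume_univ_three, lintegral_indicator measurableSet_Ioi]
    simp
  let H : ℝ × ℝ → ℝ≥0∞ := {p : ℝ × ℝ | 0 < p.2}.indicator fun p ↦
    ENNReal.ofReal (p.2 ^ 2) * g (p.1, √(p.1 ^ 2 + p.2 ^ 2))
  have hH : Measurable H := Measurable.indicator (by fun_prop)
    (measurableSet_lt measurable_const measurable_snd)
  simp_rw [h1]
  rw [lintegral_const_mul' _ _ ENNReal.ofReal_ne_top]
  congr 1
  trans ∫⁻ p, H p
  · rw [Measure.volume_eq_prod, lintegral_prod _ hH.aemeasurable]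
    rfl
  rw [← lintegral_comp_polarCoord_symm, polarCoord_target, Measure.volume_eq_prod,
    ← Measure.prod_restrict, lintegral_prod]
  · refine setLIntegral_congr_fun measurableSet_Ioi fun r hr ↦ ?_
    have hr : 0 < r := hr
    rw [← lintegral_indicator measurableSet_Ioo, ← lintegral_indicator measurableSet_Ioo]
    refine lintegral_congr fun θ ↦ ?_
    by_cases h0 : 0 < θ
    · by_cases hπ : θ < π
      · have hs : 0 < sin θ := sin_pos_of_pos_of_lt_pi h0 hπ
        rw [indicator_of_mem (s := Ioo (-π) π) ⟨by linarith, hπ⟩,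
          indicator_of_mem (s := Ioo 0 π) ⟨h0, hπ⟩]
        have : √((r * cos θ) ^ 2 + (r * sin θ) ^ 2) = r := by
          rw [mul_pow, mul_pow, ← mul_add, cos_sq_add_sin_sq, mul_one, sqrt_sq hr.le]
        simp only [polarCoord_symm_apply, H]
        rw [indicator_of_mem (show (r * cos θ, r * sin θ) ∈ {p : ℝ × ℝ | 0 < p.2} from mul_pos hr hs),
          this, smul_eq_mul, ← mul_assoc, ← mul_assoc,
          ← ENNReal.ofReal_mul hr.le, ← ENNReal.ofReal_mul (by positivity)]
        ring_nf
      · rw [indicator_of_notMem (by simp [hπ]), indicator_of_notMem (by simp [hπ])]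
    · rw [indicator_of_notMem (s := Ioo 0 π) (by simp [h0])]
      by_cases hπ : -π < θ
      · rw [indicator_of_mem (s := Ioo (-π) π) ⟨hπ, by linarith [pi_pos]⟩]
        have hs : sin θ ≤ 0 := sin_nonpos_of_nonpos_of_neg_pi_le (not_lt.1 h0) hπ.le
        simp only [polarCoord_symm_apply, H]
        rw [indicator_of_notMem, smul_zero]
        exact not_lt.2 (mul_nonpos_of_nonneg_of_nonpos hr.le hs)
      · rw [indicator_of_notMem (by simp [hπ])]
  · refine Measurable.aemeasurable ?_
    simp only [smul_eq_mul]
    exact (by fun_prop : Measurable fun p : ℝ × ℝ ↦ ENNReal.ofReal p.1).mul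
      (hH.comp continuous_polarCoord_symm.measurable)

theorem lintegral_toSphere_inner {v : EuclideanSpace ℝ (Fin 4)} (hv : ‖v‖ = 1)
    {f : ℝ → ℝ≥0∞} (hf : Measurable f) :
    ∫⁻ ω, f ⟪(ω : EuclideanSpace ℝ (Fin 4)), v⟫
        ∂(volume : Measure (EuclideanSpace ℝ (Fin 4))).toSphere =
      ENNReal.ofReal (4 * π) * ∫⁻ θ in Ioo 0 π, ENNReal.ofReal (sin θ ^ 2) * f (cos θ) := by
  let h : ℝ → ℝ≥0∞ := (Iio 1).indicator 1
  have hh : Measurable h := measurable_one.indicator measurableSet_Iio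
  let g : ℝ × ℝ → ℝ≥0∞ := fun p ↦ h p.2 * f (p.1 / p.2)
  have hg : Measurable g := by fun_prop
  set K := ∫⁻ r in Ioi (0 : ℝ), ENNReal.ofReal (r ^ 3) * h r with hK
  have hKv : K = ENNReal.ofReal (1 / 4) := by
    have h1 (r : ℝ) : ENNReal.ofReal (r ^ 3) * h r =
        (Iio 1).indicator (fun r ↦ ENNReal.ofReal (r ^ 3)) r := by
      by_cases hr : r < 1 <;> simp [h, hr]
    simp_rw [hK, h1]
    rw [setLIntegral_indicator measurableSet_Iio, Iio_inter_Ioi, Measure.restrict_congr_set Ioo_ae_eq_Ioc,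
      ← ofReal_integral_eq_lintegral_ofReal (intervalIntegral.intervalIntegrable_pow _).1,
      ← intervalIntegral.integral_of_le zero_le_one]
    · rw [integral_pow]
      norm_num
    · filter_upwards [ae_restrict_mem measurableSet_Ioc] with y hy
      exact pow_nonneg hy.1.le _
  have hL : ∫⁻ x : EuclideanSpace ℝ (Fin 4), g (⟪x, v⟫, ‖x‖) =
      K * ∫⁻ ω, f ⟪(ω : EuclideanSpace ℝ (Fin 4)), v⟫
        ∂(volume : Measure (EuclideanSpace ℝ (Fin 4))).toSphere := by
    rw [lintegral_eq_lintegral_toSphere volume (by fun_prop), ← lintegral_const_mul _ (by fun_prop)]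
    refine lintegral_congr fun ω ↦ ?_
    rw [hK, ← lintegral_mul_const _ (by fun_prop)]
    refine setLIntegral_congr_fun measurableSet_Ioi fun r hr ↦ ?_
    have hr : 0 < r := hr
    have : r * ⟪(ω : EuclideanSpace ℝ (Fin 4)), v⟫ / r = ⟪(ω : EuclideanSpace ℝ (Fin 4)), v⟫ := by
      field_simp
    simp [g, norm_smul, abs_of_pos hr, inner_smul_left, mul_assoc, this]
  have hR := lintegral_norm_inner_polar hv hg
  have hR' : ∫⁻ r in Ioi (0 : ℝ), ∫⁻ θ in Ioo 0 π,
        ENNReal.ofReal (r ^ 3) * (ENNReal.ofReal (sin θ ^ 2) * g (r * cos θ, r)) =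
      K * ∫⁻ θ in Ioo 0 π, ENNReal.ofReal (sin θ ^ 2) * f (cos θ) := by
    rw [hK, ← lintegral_mul_const _ (by fun_prop)]
    refine setLIntegral_congr_fun measurableSet_Ioi fun r hr ↦ ?_
    have hr : 0 < r := hr
    rw [← lintegral_const_mul _ (by fun_prop)]
    refine lintegral_congr fun θ ↦ ?_
    have : r * cos θ / r = cos θ := by field_simp
    simp only [g, this]
    ring
  have hK0 : K ≠ 0 := by rw [hKv]; simp
  have hKt : K ≠ ⊤ := by rw [hKv]; simp
  rw [hL, hR', mul_left_comm] at hR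
  exact (ENNReal.mul_right_inj hK0 hKt).1 hR

theorem integral_toSphere_inner {v : EuclideanSpace ℝ (Fin 4)} (hv : ‖v‖ = 1)
    {f : ℝ → ℝ} (hf : Measurable f) (hf0 : ∀ x ∈ Icc (-1) 1, 0 ≤ f x) :
    ∫ ω, f ⟪(ω : EuclideanSpace ℝ (Fin 4)), v⟫
        ∂(volume : Measure (EuclideanSpace ℝ (Fin 4))).toSphere =
      4 * π * ∫ θ in (0)..π, sin θ ^ 2 * f (cos θ) := by
  rw [integral_eq_lintegral_of_nonneg_ae,
    lintegral_toSphere_inner hv (f := fun x ↦ ENNReal.ofReal (f x)) (by fun_prop),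
    ENNReal.toReal_mul, ENNReal.toReal_ofReal (by positivity),
    intervalIntegral.integral_of_le pi_pos.le, ← Measure.restrict_congr_set Ioo_ae_eq_Ioc,
    integral_eq_lintegral_of_nonneg_ae]
  · simp_rw [ENNReal.ofReal_mul (sq_nonneg _)]
  · exact .of_forall fun θ ↦ mul_nonneg (sq_nonneg _) (hf0 _ (cos_mem_Icc θ))
  · exact Measurable.aestronglyMeasurable (by fun_prop)
  · refine .of_forall fun ω ↦ hf0 _ (abs_le.1 ?_)
    simpa [hv] using abs_real_inner_le_norm (ω : EuclideanSpace ℝ (Fin 4)) v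
  · exact Measurable.aestronglyMeasurable (by fun_prop)

theorem integral_sin_sq_div_sub_mul_cos_cube {a b : ℝ} (hb : 0 ≤ b) (hab : b < a) :
    ∫ θ in (0)..π, sin θ ^ 2 * (1 / (a - b * cos θ) ^ 3) = π / 2 / √(a ^ 2 - b ^ 2) ^ 3 := by
  have hk : 0 < a ^ 2 - b ^ 2 := by nlinarith
  set k := √(a ^ 2 - b ^ 2) with hkdef
  have hkpos : 0 < k := sqrt_pos.2 hk
  have hksq : k ^ 2 = a ^ 2 - b ^ 2 := sq_sqrt hk.le
  have hden (θ : ℝ) : 0 < a - b * cos θ := by nlinarith [cos_le_one θ]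
  let w : ℝ → ℝ := fun θ ↦ (a * cos θ - b) / (a - b * cos θ)
  have hw (θ : ℝ) : HasDerivAt w (-(k ^ 2 * sin θ) / (a - b * cos θ) ^ 2) θ := by
    have h1 : HasDerivAt (fun θ ↦ a * cos θ - b) (a * -sin θ) θ :=
      ((hasDerivAt_cos θ).const_mul a).sub_const b
    have h2 : HasDerivAt (fun θ ↦ a - b * cos θ) (-(b * -sin θ)) θ :=
      ((hasDerivAt_cos θ).const_mul b).const_sub a
    refine (h1.div h2 (hden θ).ne').congr_deriv ?_
    rw [hksq]
    congr 1
    ring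
  have hw2 (θ : ℝ) : 1 - w θ ^ 2 = (k * sin θ / (a - b * cos θ)) ^ 2 := by
    have := (hden θ).ne'
    simp only [w]
    rw [div_pow, div_pow, mul_pow, hksq, sin_sq, eq_div_iff (pow_ne_zero 2 this), sub_mul,
      div_mul_cancel₀ _ (pow_ne_zero 2 this)]
    ring
  let G : ℝ → ℝ := fun θ ↦
    (arccos (w θ) - k * sin θ / (a - b * cos θ) * w θ) / (2 * k ^ 3)
  have hG (θ : ℝ) (hθ : θ ∈ Ioo 0 π) :
      HasDerivAt G (sin θ ^ 2 * (1 / (a - b * cos θ) ^ 3)) θ := by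
    have hs : 0 < sin θ := sin_pos_of_pos_of_lt_pi hθ.1 hθ.2
    have hd := hden θ
    have hpos : 0 < k * sin θ / (a - b * cos θ) := by positivity
    have hlt : w θ ^ 2 < 1 := by nlinarith [hw2 θ]
    have hne1 : w θ ≠ -1 := by rintro h; rw [h] at hlt; norm_num at hlt
    have hne2 : w θ ≠ 1 := by rintro h; rw [h] at hlt; norm_num at hlt
    have h1 := (hasDerivAt_arccos hne1 hne2).comp θ (hw θ)
    rw [hw2, sqrt_sq hpos.le] at h1
    have h2 : HasDerivAt (fun θ ↦ a - b * cos θ) (-(b * -sin θ)) θ :=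
      ((hasDerivAt_cos θ).const_mul b).const_sub a
    have hne := hd.ne'
    have h3 : HasDerivAt (fun θ ↦ k * sin θ / (a - b * cos θ)) (k / (a - b * cos θ) * w θ) θ := by
      refine (((hasDerivAt_sin θ).const_mul k).div h2 hne).congr_deriv ?_
      simp only [w]
      rw [div_mul_div_comm, ← sq]
      congr 1
      linear_combination -k * b * sin_sq_add_cos_sq θ
    refine ((h1.sub (h3.mul (hw θ))).div_const (2 * k ^ 3)).congr_deriv ?_
    have e1 : -(1 / (k * sin θ / (a - b * cos θ))) * (-(k ^ 2 * sin θ) / (a - b * cos θ) ^ 2) =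
        k / (a - b * cos θ) := by field_simp
    have e2 : k * sin θ / (a - b * cos θ) * (-(k ^ 2 * sin θ) / (a - b * cos θ) ^ 2) =
        -(k / (a - b * cos θ) * (k * sin θ / (a - b * cos θ)) ^ 2) := by field_simp
    rw [e1, e2]
    have e3 : k / (a - b * cos θ) - (k / (a - b * cos θ) * w θ * w θ +
        -(k / (a - b * cos θ) * (k * sin θ / (a - b * cos θ)) ^ 2)) =
        k / (a - b * cos θ) * (2 * (k * sin θ / (a - b * cos θ)) ^ 2) := by
      linear_combination k / (a - b * cos θ) * hw2 θ
    rw [e3]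
    field_simp
  have hcont : Continuous G := by
    have := fun θ ↦ (hden θ).ne'
    fun_prop (disch := assumption)
  rw [intervalIntegral.integral_eq_sub_of_hasDerivAt_of_le pi_pos.le hcont.continuousOn hG]
  · have h1 : a - b ≠ 0 := by linarith
    have h2 : a + b ≠ 0 := by linarith
    have h3 : (-a - b) / (a + b) = -1 := by field_simp; ring
    simp [G, w, h1, h3]
    field_simp
  · refine Continuous.intervalIntegrable ?_ _ _
    have := fun θ ↦ (pow_pos (hden θ) 3).ne'
    fun_prop (disch := assumption)

theorem integral_toSphere_inv_sub_inner_cube {a : ℝ} {p : EuclideanSpace ℝ (Fin 4)}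
    (hp : ‖p‖ < a) :
    ∫ ω, 1 / (a - ⟪(ω : EuclideanSpace ℝ (Fin 4)), p⟫) ^ 3
        ∂(volume : Measure (EuclideanSpace ℝ (Fin 4))).toSphere =
      2 * π ^ 2 / √(a ^ 2 - ‖p‖ ^ 2) ^ 3 := by
  obtain ⟨v, hv, hpv⟩ : ∃ v : EuclideanSpace ℝ (Fin 4), ‖v‖ = 1 ∧ p = ‖p‖ • v := by
    by_cases h : p = 0
    · obtain ⟨v, hv⟩ := exists_norm_eq (EuclideanSpace ℝ (Fin 4)) zero_le_one
      exact ⟨v, hv, by simp [h]⟩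
    · exact ⟨‖p‖⁻¹ • p, by simp [norm_smul, h], by simp [smul_smul, h]⟩
  have hf (ω : sphere (0 : EuclideanSpace ℝ (Fin 4)) 1) :
      1 / (a - ⟪(ω : EuclideanSpace ℝ (Fin 4)), p⟫) ^ 3 =
      (fun x ↦ 1 / (a - ‖p‖ * x) ^ 3) ⟪(ω : EuclideanSpace ℝ (Fin 4)), v⟫ := by
    conv_lhs => rw [hpv, inner_smul_right]
  simp_rw [hf]
  rw [integral_toSphere_inner hv (f := fun x ↦ 1 / (a - ‖p‖ * x) ^ 3) (by fun_prop),
    integral_sin_sq_div_sub_mul_cos_cube (norm_nonneg p) hp]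
  · ring
  · intro x hx
    have : 0 < a - ‖p‖ * x := by nlinarith [norm_nonneg p, hx.2]
    positivity

theorem integral_two_mul_div_cube {A B : ℝ} (hA : 0 < A) (hB : 0 < B) :
    ∫ y in (0)..1, 2 * y * (1 / (y * A + (1 - y) * B) ^ 3) = 1 / (A ^ 2 * B) := by
  have hpos {y : ℝ} (hy : y ∈ uIcc (0 : ℝ) 1) : 0 < y * A + (1 - y) * B := by
    rw [uIcc_of_le zero_le_one] at hy
    rcases hy.1.eq_or_lt with rfl | h
    · simpa using hB
    · nlinarith [mul_pos h hA, mul_nonneg (sub_nonneg.2 hy.2) hB.le]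
  have hd (y : ℝ) (hy : y ∈ uIcc (0 : ℝ) 1) :
      HasDerivAt (fun y ↦ y ^ 2 / (B * (y * A + (1 - y) * B) ^ 2))
        (2 * y * (1 / (y * A + (1 - y) * B) ^ 3)) y := by
    have h0 := (hpos hy).ne'
    have h1 : HasDerivAt (fun y ↦ y * A + (1 - y) * B) (1 * A + -1 * B) y :=
      ((hasDerivAt_id y).mul_const A).add (((hasDerivAt_id y).const_sub 1).mul_const B)
    have h2 : HasDerivAt (fun y ↦ (y * A + (1 - y) * B) ^ 2)
        (2 * (y * A + (1 - y) * B) * (A - B)) y :=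
      (h1.pow 2).congr_deriv (by push_cast; ring)
    refine ((hasDerivAt_pow 2 y).div (h2.const_mul B) (by positivity)).congr_deriv ?_
    have h3 : (1 - y) * B = (y * A + (1 - y) * B) - y * A := by ring
    set L := y * A + (1 - y) * B
    field_simp
    simp only [Nat.cast_ofNat, Nat.add_one_sub_one, pow_one]
    linear_combination (-2 * y * L) * h3
  rw [intervalIntegral.integral_eq_sub_of_hasDerivAt hd]
  · simp; field_simp
  · refine ContinuousOn.intervalIntegrable fun y hy ↦ ContinuousAt.continuousWithinAt ?_
    have := (pow_pos (hpos hy) 3).ne'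
    fun_prop (disch := assumption)

theorem integral_two_mul_div_sqrt_cube {D : ℝ} (hD : 1 < D) :
    ∫ y in (0)..1, 2 * y * (2 * π ^ 2 / √(y ^ 2 + (1 - y) ^ 2 + 2 * y * (1 - y) * D) ^ 3) =
      4 * π ^ 2 / (1 + D) := by
  have hpos {y : ℝ} (hy : y ∈ uIcc (0 : ℝ) 1) :
      0 < y ^ 2 + (1 - y) ^ 2 + 2 * y * (1 - y) * D := by
    rw [uIcc_of_le zero_le_one] at hy
    nlinarith [mul_nonneg (mul_nonneg hy.1 (sub_nonneg.2 hy.2)) (zero_le_one.trans hD.le),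
      sq_nonneg (2 * y - 1)]
  have hD1 : D - 1 ≠ 0 := by linarith
  have hD2 : D + 1 ≠ 0 := by linarith
  have hd (y : ℝ) (hy : y ∈ uIcc (0 : ℝ) 1) :
      HasDerivAt (fun y ↦ 4 * π ^ 2 / (D + 1) * (1 / (D - 1) + y) /
          √(y ^ 2 + (1 - y) ^ 2 + 2 * y * (1 - y) * D))
        (2 * y * (2 * π ^ 2 / √(y ^ 2 + (1 - y) ^ 2 + 2 * y * (1 - y) * D) ^ 3)) y := by
    have h0 := hpos hy
    have h1 : HasDerivAt (fun y ↦ y ^ 2 + (1 - y) ^ 2 + 2 * y * (1 - y) * D)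
        (2 * (1 - D) * (2 * y - 1)) y := by
      have e := hasDerivAt_id y
      refine (((e.pow 2).add ((e.const_sub 1).pow 2)).add
        (((e.const_mul 2).mul (e.const_sub 1)).mul_const D)).congr_deriv ?_
      simp
      ring
    have hs := sqrt_pos.2 h0
    have hsq := sq_sqrt h0.le
    refine (((((hasDerivAt_id y).const_add (1 / (D - 1))).const_mul
      (4 * π ^ 2 / (D + 1))).div (h1.sqrt h0.ne') hs.ne')).congr_deriv ?_
    simp only [id]
    set R := √(y ^ 2 + (1 - y) ^ 2 + 2 * y * (1 - y) * D)
    field_simp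
    rw [hsq]
    ring
  rw [intervalIntegral.integral_eq_sub_of_hasDerivAt hd]
  · simp; field_simp; ring
  · refine ContinuousOn.intervalIntegrable fun y hy ↦ ContinuousAt.continuousWithinAt ?_
    have := (pow_pos (sqrt_pos.2 (hpos hy)) 3).ne'
    fun_prop (disch := assumption)

theorem sub_inner_pos {a : ℝ} {p : EuclideanSpace ℝ (Fin 4)} (hp : ‖p‖ < a)
    (ω : sphere (0 : EuclideanSpace ℝ (Fin 4)) 1) :
    0 < a - ⟪(ω : EuclideanSpace ℝ (Fin 4)), p⟫ := by
  have := real_inner_le_norm (ω : EuclideanSpace ℝ (Fin 4)) p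
  simp at this
  linarith

theorem integral_toSphere_inv_sq_mul_inv {a₁ a₂ : ℝ} {p₁ p₂ : EuclideanSpace ℝ (Fin 4)}
    (hp₁ : ‖p₁‖ < a₁) (hp₂ : ‖p₂‖ < a₂) (h₁ : a₁ ^ 2 - ‖p₁‖ ^ 2 = 1) (h₂ : a₂ ^ 2 - ‖p₂‖ ^ 2 = 1)
    (hD : 1 < a₁ * a₂ - ⟪p₁, p₂⟫) :
    ∫ ω, 1 / ((a₁ - ⟪(ω : EuclideanSpace ℝ (Fin 4)), p₁⟫) ^ 2 *
          (a₂ - ⟪(ω : EuclideanSpace ℝ (Fin 4)), p₂⟫))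
        ∂(volume : Measure (EuclideanSpace ℝ (Fin 4))).toSphere =
      4 * π ^ 2 / (1 + (a₁ * a₂ - ⟪p₁, p₂⟫)) := by
  have hpos {y : ℝ} (hy : y ∈ Icc (0 : ℝ) 1) (ω : sphere (0 : EuclideanSpace ℝ (Fin 4)) 1) :
      0 < y * (a₁ - ⟪(ω : EuclideanSpace ℝ (Fin 4)), p₁⟫) +
        (1 - y) * (a₂ - ⟪(ω : EuclideanSpace ℝ (Fin 4)), p₂⟫) := by
    have e1 := sub_inner_pos hp₁ ω
    have e2 := sub_inner_pos hp₂ ω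
    rcases hy.1.eq_or_lt with rfl | h
    · simpa using e2
    · nlinarith [mul_pos h e1, mul_nonneg (sub_nonneg.2 hy.2) e2.le]
  simp_rw [← integral_two_mul_div_cube (sub_inner_pos hp₁ _) (sub_inner_pos hp₂ _)]
  rw [← intervalIntegral_integral_swap, ← integral_two_mul_div_sqrt_cube hD]
  · refine intervalIntegral.integral_congr fun y hy ↦ ?_
    rw [uIcc_of_le zero_le_one] at hy
    rw [integral_const_mul]
    congr 1
    have hlt : ‖y • p₁ + (1 - y) • p₂‖ < y * a₁ + (1 - y) * a₂ := by
      refine (norm_add_le _ _).trans_lt ?_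
      rw [norm_smul, norm_smul, norm_of_nonneg hy.1, norm_of_nonneg (sub_nonneg.2 hy.2)]
      rcases hy.1.eq_or_lt with rfl | h
      · simpa using hp₂
      · nlinarith [mul_lt_mul_of_pos_left hp₁ h,
          mul_le_mul_of_nonneg_left hp₂.le (sub_nonneg.2 hy.2)]
    have hnorm : (y * a₁ + (1 - y) * a₂) ^ 2 - ‖y • p₁ + (1 - y) • p₂‖ ^ 2 =
        y ^ 2 + (1 - y) ^ 2 + 2 * y * (1 - y) * (a₁ * a₂ - ⟪p₁, p₂⟫) := by
      rw [norm_add_sq_real, norm_smul, norm_smul, mul_pow, mul_pow, inner_smul_left,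
        inner_smul_right, norm_eq_abs, norm_eq_abs, sq_abs, sq_abs]
      simp only [conj_trivial]
      linear_combination y ^ 2 * h₁ + (1 - y) ^ 2 * h₂
    rw [← hnorm, ← integral_toSphere_inv_sub_inner_cube hlt]
    refine integral_congr_ae (.of_forall fun ω ↦ ?_)
    simp only [inner_add_right, inner_smul_right]
    ring_nf
  · rw [uIoc_of_le zero_le_one]
    rw [← Measure.restrict_univ (μ := (volume : Measure (EuclideanSpace ℝ (Fin 4))).toSphere),
      Measure.prod_restrict]
    change IntegrableOn _ _ _
    refine IntegrableOn.mono_set (t := Icc (0 : ℝ) 1 ×ˢ univ) ?_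
      (prod_mono_left Ioc_subset_Icc_self)
    refine ContinuousOn.integrableOn_compact (isCompact_Icc.prod isCompact_univ) fun q hq ↦
      ContinuousAt.continuousWithinAt ?_
    have := (pow_pos (hpos hq.1 q.2) 3).ne'
    simp only [Function.uncurry_def]
    fun_prop (disch := assumption)

/-- The hyperbolic cosine of the distance between the points of hyperbolic space which correspond
to the bubbles with parameters `(P, s)` and `(Q, t)`, when `⟪P, Q⟫ = 1 - w`. -/
def bubbleCosh (w s t : ℝ) : ℝ :=
  (s * t * w + (s / t + t / s) * (2 - w) + w / (s * t)) / 4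

theorem bubble_eq_one_div (P : S3) {t : ℝ} (ht : 0 < t) (x : S3) :
    bubble P t x = 1 / ((t + 1 / t) / 2 - ⟪(x : EuclideanSpace ℝ (Fin 4)),
      ((t - 1 / t) / 2) • (P : EuclideanSpace ℝ (Fin 4))⟫) := by
  have h : (1 + ((t ^ 2 - 1) / 2) *
      (1 - ⟪(x : EuclideanSpace ℝ (Fin 4)), (P : EuclideanSpace ℝ (Fin 4))⟫)) =
      t * ((t + 1 / t) / 2 - ⟪(x : EuclideanSpace ℝ (Fin 4)),
      ((t - 1 / t) / 2) • (P : EuclideanSpace ℝ (Fin 4))⟫) := by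
    rw [inner_smul_right]
    field_simp
    ring
  rw [bubble, h, div_mul_eq_div_div, div_self ht.ne']

theorem integral_bubble_sq_mul_bubble {P Q : S3} {s t : ℝ} (hs : 1 < s) (ht : 1 < t)
    (hPQ : ⟪(P : EuclideanSpace ℝ (Fin 4)), (Q : EuclideanSpace ℝ (Fin 4))⟫ < 1) :
    ∫ x, (bubble P s x) ^ 2 * bubble Q t x ∂μS3 =
      4 * π ^ 2 / (1 + bubbleCosh
        (1 - ⟪(P : EuclideanSpace ℝ (Fin 4)), (Q : EuclideanSpace ℝ (Fin 4))⟫) s t) := by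
  have hs0 : 0 < s := by linarith
  have ht0 : 0 < t := by linarith
  have hnorm (P : S3) {t : ℝ} (ht : 1 < t) :
      ‖((t - 1 / t) / 2) • (P : EuclideanSpace ℝ (Fin 4))‖ = (t - 1 / t) / 2 := by
    have : 1 / t < 1 := by rw [div_lt_one (by linarith)]; exact ht
    simp only [norm_smul, norm_eq_of_mem_sphere, mul_one]
    exact norm_of_nonneg (by linarith)
  have hlt (P : S3) {t : ℝ} (ht : 1 < t) :
      ‖((t - 1 / t) / 2) • (P : EuclideanSpace ℝ (Fin 4))‖ < (t + 1 / t) / 2 := by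
    have : 0 < 1 / t := by positivity
    rw [hnorm P ht]
    linarith
  have hsq (P : S3) {t : ℝ} (ht : 1 < t) :
      ((t + 1 / t) / 2) ^ 2 - ‖((t - 1 / t) / 2) • (P : EuclideanSpace ℝ (Fin 4))‖ ^ 2 = 1 := by
    have : t ≠ 0 := by positivity
    rw [hnorm P ht]
    field_simp
    ring
  set c := ⟪(P : EuclideanSpace ℝ (Fin 4)), (Q : EuclideanSpace ℝ (Fin 4))⟫ with hc
  have hD : (s + 1 / s) / 2 * ((t + 1 / t) / 2) -
      ⟪((s - 1 / s) / 2) • (P : EuclideanSpace ℝ (Fin 4)),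
        ((t - 1 / t) / 2) • (Q : EuclideanSpace ℝ (Fin 4))⟫ = bubbleCosh (1 - c) s t := by
    rw [inner_smul_left, inner_smul_right, ← hc, bubbleCosh]
    simp only [conj_trivial]
    field_simp
    ring
  have hD1 : 1 < bubbleCosh (1 - c) s t := by
    have e : bubbleCosh (1 - c) s t - 1 =
        ((s - t) ^ 2 * 2 + (1 - c) * ((s ^ 2 - 1) * (t ^ 2 - 1))) / (4 * s * t) := by
      rw [bubbleCosh]
      field_simp
      ring
    have : 0 < bubbleCosh (1 - c) s t - 1 := by
      rw [e]
      have h1 : 0 < s ^ 2 - 1 := by nlinarith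
      have h2 : 0 < t ^ 2 - 1 := by nlinarith
      have h3 : 0 < 1 - c := by linarith
      positivity
    linarith
  rw [← hD] at hD1 ⊢
  rw [← integral_toSphere_inv_sq_mul_inv (hlt P hs) (hlt Q ht) (hsq P hs) (hsq Q ht) hD1, μS3]
  refine integral_congr_ae (.of_forall fun x ↦ ?_)
  simp only [bubble_eq_one_div _ hs0, bubble_eq_one_div _ ht0]
  rw [div_pow, one_pow, div_mul_div_comm, one_mul]

theorem hasDerivAt_bubbleCosh (w : ℝ) {s t : ℝ} (hs : 0 < s) (ht : 0 < t) :
    HasDerivAt (fun s ↦ bubbleCosh w s t)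
      ((t * w + ((1 / t - t / s ^ 2) * (2 - w) - w / (s ^ 2 * t))) / 4) s := by
  have e := hasDerivAt_id s
  have h1 := (((e.mul_const t).mul_const w).add
    (((e.div_const t).add ((hasDerivAt_inv hs.ne').const_mul t)).mul_const (2 - w))).add
    (((hasDerivAt_inv hs.ne').const_mul (w / t)))
  refine ((h1.div_const 4).congr_of_eventuallyEq (.of_forall fun x ↦ ?_)).congr_deriv ?_
  · simp only [bubbleCosh, id, Pi.add_apply]
    ring
  · field_simp
    ring

theorem abs_leading_term_sub_le {s t w A : ℝ} (hs : 1 ≤ s) (ht : 1 ≤ t) (hw : 0 < w) (hw2 : w ≤ 2)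
    (hA : 1 ≤ A) (hst : s ≤ A ^ 2 * t) (hts : t ≤ A ^ 2 * s) :
    |1 / (w * s ^ 2 * t) - (t * w + ((1 / t - t / s ^ 2) * (2 - w) - w / (s ^ 2 * t))) /
      (s * t * w + (4 + (s / t + t / s) * (2 - w) + w / (s * t))) ^ 2| ≤
      200 * A ^ 4 / (w ^ 3 * (s ^ 2 * t ^ 2)) := by
  have hs0 : 0 < s := by linarith
  have ht0 : 0 < t := by linarith
  have hA1 : 1 ≤ A ^ 2 := one_le_pow₀ hA
  have hst1 : 1 ≤ s * t := one_le_mul_of_one_le_of_one_le hs ht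
  have h1 : s / t ≤ A ^ 2 := (div_le_iff₀ ht0).2 hst
  have h2 : t / s ≤ A ^ 2 := (div_le_iff₀ hs0).2 hts
  have h3 : w / (s * t) ≤ 2 := (div_le_iff₀ (by positivity)).2 (by linarith)
  set R := 4 + (s / t + t / s) * (2 - w) + w / (s * t) with hR
  have hR0 : 0 < R := by
    have : 0 ≤ (s / t + t / s) * (2 - w) := mul_nonneg (by positivity) (by linarith)
    positivity
  have hR1 : R ≤ 10 * A ^ 2 := by
    have : (s / t + t / s) * (2 - w) ≤ (A ^ 2 + A ^ 2) * 2 :=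
      mul_le_mul (add_le_add h1 h2) (by linarith) (by linarith) (by positivity)
    linarith
  set E := (1 / t - t / s ^ 2) * (2 - w) - w / (s ^ 2 * t) with hE
  have hE1 : |s ^ 2 * t * E| ≤ 6 * A ^ 2 * (s * t) := by
    have : s ^ 2 * t * E = (s ^ 2 - t ^ 2) * (2 - w) - w := by
      rw [hE]
      field_simp
    rw [this, abs_le]
    have k1 : s ^ 2 ≤ A ^ 2 * (s * t) := by nlinarith
    have k2 : t ^ 2 ≤ A ^ 2 * (s * t) := by nlinarith
    have k3 : 1 ≤ A ^ 2 * (s * t) := one_le_mul_of_one_le_of_one_le hA1 hst1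
    constructor <;> nlinarith [sq_nonneg s, sq_nonneg t]
  clear_value R E
  have hX : 0 < s * t * w + R := by positivity
  have key : 1 / (w * s ^ 2 * t) - (t * w + E) / (s * t * w + R) ^ 2 =
      (2 * (s * t * w) * R + R ^ 2 - w * (s ^ 2 * t * E)) /
        (w * s ^ 2 * t * (s * t * w + R) ^ 2) := by
    field_simp
    ring
  have hR2 : R ^ 2 ≤ 100 * A ^ 4 * (s * t) := by
    have : R ^ 2 ≤ (10 * A ^ 2) ^ 2 := pow_le_pow_left₀ hR0.le hR1 2
    nlinarith [pow_pos (show 0 < A by linarith) 4]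
  have hA2 : A ^ 2 ≤ A ^ 4 := pow_le_pow_right₀ hA (by norm_num)
  have hnum : |2 * (s * t * w) * R + R ^ 2 - w * (s ^ 2 * t * E)| ≤ 200 * A ^ 4 * (s * t) := by
    have n1 : 2 * (s * t * w) * R ≤ 40 * A ^ 4 * (s * t) := by
      calc 2 * (s * t * w) * R ≤ 2 * (s * t * 2) * (10 * A ^ 4) := by
            gcongr
            linarith
        _ = _ := by ring
    have n2 : |w * (s ^ 2 * t * E)| ≤ 12 * A ^ 4 * (s * t) := by
      rw [abs_mul, abs_of_pos hw]
      calc w * |s ^ 2 * t * E| ≤ 2 * (6 * A ^ 4 * (s * t)) := by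
            gcongr
            exact hE1.trans (by gcongr)
        _ = _ := by ring
    have n3 : 0 ≤ 2 * (s * t * w) * R := by positivity
    have n4 : 0 ≤ A ^ 4 * (s * t) := by positivity
    rw [abs_le] at n2 ⊢
    constructor <;> nlinarith [sq_nonneg R]
  rw [key, abs_div, abs_of_pos (show 0 < w * s ^ 2 * t * (s * t * w + R) ^ 2 by positivity)]
  calc _ ≤ 200 * A ^ 4 * (s * t) / (w * s ^ 2 * t * (s * t * w) ^ 2) := by
        have hle : (s * t * w) ^ 2 ≤ (s * t * w + R) ^ 2 :=
          pow_le_pow_left₀ (by positivity) (by linarith) 2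
        exact div_le_div₀ (by positivity) hnum (by positivity)
          (mul_le_mul_of_nonneg_left hle (by positivity))
    _ = 200 * A ^ 4 / (w ^ 3 * (s ^ 2 * t ^ 2)) / s := by field_simp
    _ ≤ _ := div_le_self (by positivity) hs

theorem deriv_integral_bubble {P Q : S3} {s t : ℝ} (hs : 1 < s) (ht : 1 < t)
    (hPQ : ⟪(P : EuclideanSpace ℝ (Fin 4)), (Q : EuclideanSpace ℝ (Fin 4))⟫ < 1) {w : ℝ}
    (hw : w = 1 - ⟪(P : EuclideanSpace ℝ (Fin 4)), (Q : EuclideanSpace ℝ (Fin 4))⟫)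
    (hw2 : w ≤ 2) :
    deriv (fun s ↦ ∫ x, (bubble P s x) ^ 2 * bubble Q t x ∂μS3) s =
      -(16 * π ^ 2 * ((t * w + ((1 / t - t / s ^ 2) * (2 - w) - w / (s ^ 2 * t))) /
        (s * t * w + (4 + (s / t + t / s) * (2 - w) + w / (s * t))) ^ 2)) := by
  have hs0 : 0 < s := by linarith
  have ht0 : 0 < t := by linarith
  have hev : (fun s ↦ ∫ x, (bubble P s x) ^ 2 * bubble Q t x ∂μS3) =ᶠ[nhds s]
      fun s ↦ 4 * π ^ 2 / (1 + bubbleCosh w s t) := by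
    filter_upwards [lt_mem_nhds hs] with s hs
    rw [integral_bubble_sq_mul_bubble hs ht hPQ, hw]
  have hX : s * t * w + (4 + (s / t + t / s) * (2 - w) + w / (s * t)) =
      4 * (1 + bubbleCosh w s t) := by
    rw [bubbleCosh]
    ring
  have hpos : 0 < 1 + bubbleCosh w s t := by
    have h1 : 0 < w := by linarith
    have h2 : 0 ≤ 2 - w := by linarith
    rw [bubbleCosh]
    positivity
  set N := t * w + ((1 / t - t / s ^ 2) * (2 - w) - w / (s ^ 2 * t)) with hN
  have hd : HasDerivAt (fun s ↦ 4 * π ^ 2 / (1 + bubbleCosh w s t))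
      ((0 * (1 + bubbleCosh w s t) - 4 * π ^ 2 * (N / 4)) / (1 + bubbleCosh w s t) ^ 2) s :=
    (hasDerivAt_const s (4 * π ^ 2)).div
      ((hasDerivAt_bubbleCosh w hs0 ht0).const_add 1) hpos.ne'
  rw [hev.deriv_eq, hd.deriv, hX]
  field_simp
  ring

theorem stmt12 (ε₀ A : ℝ) (hε₀ : ε₀ ∈ Set.Ioo 0 π) (hA : 1 ≤ A) :
    ∃ C > 0, ∃ τ₀ ∈ Set.Ioo (0 : ℝ) 1, ∀ τ ∈ Set.Ioo (0 : ℝ) τ₀, ∀ t₁ t₂ : ℝ,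
      A⁻¹ * τ ^ (-(1 : ℝ) / 2) < t₁ → t₁ < A * τ ^ (-(1 : ℝ) / 2) →
      A⁻¹ * τ ^ (-(1 : ℝ) / 2) < t₂ → t₂ < A * τ ^ (-(1 : ℝ) / 2) →
      ∀ P₁ P₂ : S3, ε₀ ≤ geoDist P₁ P₂ →
      |deriv (fun s => ∫ x, (bubble P₁ s x) ^ 2 * bubble P₂ t₂ x ∂μS3) t₁ +
          16 * π ^ 2 * (green P₁ P₂ / (t₁ ^ 2 * t₂))| ≤ C * τ ^ 2 := by
  have hA0 : 0 < A := by linarith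
  have hcos : cos ε₀ < 1 := by
    rw [← cos_zero]
    exact cos_lt_cos_of_nonneg_of_le_pi le_rfl hε₀.2.le hε₀.1
  have hκ : 0 < 1 - cos ε₀ := by linarith
  refine ⟨16 * π ^ 2 * (200 * A ^ 8 / (1 - cos ε₀) ^ 3), by positivity, A⁻¹ ^ 2 / 2, ?_, ?_⟩
  · have h1 : A⁻¹ ^ 2 ≤ 1 := pow_le_one₀ (by positivity) (inv_le_one_of_one_le₀ hA)
    exact ⟨by positivity, by linarith⟩
  intro τ hτ s t hs1 hs2 ht1 ht2 P Q hPQ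
  have hτ0 : 0 < τ := hτ.1
  set σ := τ ^ (-(1 : ℝ) / 2) with hσ
  have hσ0 : 0 < σ := rpow_pos_of_pos hτ0 _
  have hσ2 : σ ^ 2 * τ = 1 := by
    have : σ ^ 2 = τ⁻¹ := by
      rw [hσ, ← rpow_natCast, ← rpow_mul hτ0.le, ← rpow_neg_one]
      norm_num
    rw [this, inv_mul_cancel₀ hτ0.ne']
  have hσA : 1 < A⁻¹ * σ := by
    have h1 : τ < A⁻¹ ^ 2 := by
      have : 0 < A⁻¹ ^ 2 := by positivity
      linarith [hτ.2]
    have h2 : 1 < (A⁻¹ * σ) ^ 2 := by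
      rw [mul_pow, ← hσ2, mul_comm]
      gcongr
    nlinarith [show 0 < A⁻¹ * σ by positivity]
  have hs : 1 < s := hσA.trans hs1
  have ht : 1 < t := hσA.trans ht1
  have hle {x y : ℝ} (hx : x < A * σ) (hy : A⁻¹ * σ < y) : x ≤ A ^ 2 * y := by
    have : A * σ = A ^ 2 * (A⁻¹ * σ) := by field_simp
    nlinarith [mul_lt_mul_of_pos_left hy (pow_pos hA0 2)]
  set c := ⟪(P : EuclideanSpace ℝ (Fin 4)), (Q : EuclideanSpace ℝ (Fin 4))⟫ with hc
  have hc1 : |c| ≤ 1 := by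
    simpa using abs_real_inner_le_norm (P : EuclideanSpace ℝ (Fin 4)) Q
  have hcε : c ≤ cos ε₀ := by
    rw [← cos_arccos (abs_le.1 hc1).1 (abs_le.1 hc1).2]
    exact cos_le_cos_of_nonneg_of_le_pi hε₀.1.le (arccos_le_pi _) hPQ
  have hw : 0 < 1 - c := by linarith
  have hw2 : 1 - c ≤ 2 := by linarith [(abs_le.1 hc1).1]
  rw [deriv_integral_bubble hs ht (hcε.trans_lt hcos) rfl hw2, green, ← hc]
  have hsplit : 1 / (1 - c) / (s ^ 2 * t) = 1 / ((1 - c) * s ^ 2 * t) := by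
    rw [div_div, mul_assoc]
  have hπ : 0 < 16 * π ^ 2 := by positivity
  rw [hsplit, neg_add_eq_sub, ← mul_sub, abs_mul, abs_of_pos hπ,
    mul_assoc (16 * π ^ 2)]
  refine mul_le_mul_of_nonneg_left ?_ (by positivity)
  refine (abs_leading_term_sub_le hs.le ht.le hw hw2 hA (hle hs2 ht1) (hle ht2 hs1)).trans ?_
  have hστ : 1 ≤ A ^ 4 * (s ^ 2 * t ^ 2) * τ ^ 2 := by
    calc 1 = A ^ 4 * ((A⁻¹ * σ) ^ 2 * (A⁻¹ * σ) ^ 2) * τ ^ 2 := by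
          have : A ^ 4 * ((A⁻¹ * σ) ^ 2 * (A⁻¹ * σ) ^ 2) * τ ^ 2 = (σ ^ 2 * τ) ^ 2 := by
            field_simp
          rw [this, hσ2, one_pow]
      _ ≤ _ := by gcongr
  have hst : 0 < s ^ 2 * t ^ 2 := by positivity
  calc 200 * A ^ 4 / ((1 - c) ^ 3 * (s ^ 2 * t ^ 2))
      ≤ 200 * A ^ 4 / ((1 - cos ε₀) ^ 3 * (s ^ 2 * t ^ 2)) := by gcongr
    _ = 200 * A ^ 4 / (1 - cos ε₀) ^ 3 * (1 / (s ^ 2 * t ^ 2)) := by field_simp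
    _ ≤ 200 * A ^ 4 / (1 - cos ε₀) ^ 3 * (A ^ 4 * τ ^ 2) := by
        gcongr
        rw [div_le_iff₀ hst]
        linarith
    _ = _ := by ring
end
end

section
/- For every A ≥ 1 there exist constants C > 0 and τ₀ ∈ (0,1), depending only on A, such that for all τ ∈ (0, τ₀), every P₁ ∈ S³, and every t₁ with A⁻¹ τ^{−1/2} < t₁ < A τ^{−1/2}, the derivative at s = t₁ of the function s ↦ ∫_{S³} δ_{P₁,s}(x)^{3−τ} dx satisfies | (d/ds)|_{s=t₁} ∫_{S³} δ_{P₁,s}^{3−τ} dx + 2π² · τ/t₁ | ≤ C τ^{5/2} |log τ|. -/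
open MeasureTheory Real Set Metric
open scoped RealInnerProductSpace

noncomputable section

lemma measurable_inner_sphere (P : S3) :
    Measurable fun x : S3 ↦ ⟪(x : EuclideanSpace ℝ (Fin 4)), (P : EuclideanSpace ℝ (Fin 4))⟫ := by
  fun_prop

/-- Averaging a zonal function over the unit ball instead of the unit sphere. -/
lemma lintegral_sphere_mul_eq_lintegral_ball {g : ℝ → ENNReal} (hg : Measurable g) (P : S3) :
    (∫⁻ x : S3, g ⟪(x : EuclideanSpace ℝ (Fin 4)), (P : EuclideanSpace ℝ (Fin 4))⟫ ∂μS3) *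
        ENNReal.ofReal (1 / 4) =
      ∫⁻ x : EuclideanSpace ℝ (Fin 4),
        g (⟪x, (P : EuclideanSpace ℝ (Fin 4))⟫ / ‖x‖) * (Iio 1).indicator 1 ‖x‖ := by
  have key := (volume : Measure (EuclideanSpace ℝ (Fin 4))).measurePreserving_homeomorphUnitSphereProd
  have h1 : ∀ᵐ x : EuclideanSpace ℝ (Fin 4), x ∈ ({0}ᶜ : Set (EuclideanSpace ℝ (Fin 4))) := by
    simp [ae_iff]
  rw [← Measure.restrict_eq_self_of_ae_mem h1,
    ← lintegral_subtype_comap (measurableSet_singleton _).compl]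
  have hG : Measurable fun x : S3 ↦
      g ⟪(x : EuclideanSpace ℝ (Fin 4)), (P : EuclideanSpace ℝ (Fin 4))⟫ :=
    hg.comp (measurable_inner_sphere P)
  have h2 : Measurable fun z : S3 × Ioi (0 : ℝ) ↦
      g ⟪(z.1 : EuclideanSpace ℝ (Fin 4)), (P : EuclideanSpace ℝ (Fin 4))⟫ *
        (Iio (⟨1, mem_Ioi.2 one_pos⟩ : Ioi (0 : ℝ))).indicator 1 z.2 := by
    refine (hG.comp measurable_fst).mul ?_
    exact (measurable_one.indicator measurableSet_Iio).comp measurable_snd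
  have h3 := key.lintegral_comp h2
  rw [lintegral_prod_mul hG.aemeasurable
    (measurable_one.indicator measurableSet_Iio).aemeasurable,
    lintegral_indicator_one measurableSet_Iio, Measure.volumeIoiPow_apply_Iio] at h3
  have h4 : (1 : ℝ) ^ (Module.finrank ℝ (EuclideanSpace ℝ (Fin 4)) - 1 + 1) /
      (((Module.finrank ℝ (EuclideanSpace ℝ (Fin 4)) - 1 : ℕ) : ℝ) + 1) = 1 / 4 := by
    simp; norm_num
  rw [h4] at h3
  rw [μS3, ← h3]
  refine lintegral_congr fun x ↦ ?_
  congr 1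
  · simp only [homeomorphUnitSphereProd_apply_fst_coe, real_inner_smul_left]
    rw [div_eq_inv_mul]
  · rw [indicator_apply, indicator_apply]
    simp only [mem_Iio, ← Subtype.coe_lt_coe, homeomorphUnitSphereProd_apply_snd_coe,
      Pi.one_apply]

/-- Isometric splitting of `ℝ⁴` along the line through a unit vector. -/
lemma exists_linearIsometryEquiv_prod (P : S3) :
    ∃ e : EuclideanSpace ℝ (Fin 4) ≃ₗᵢ[ℝ] WithLp 2 (ℝ × EuclideanSpace ℝ (Fin 3)),
      e P = WithLp.toLp 2 (1, 0) := by
  have hdim : Module.finrank ℝ (EuclideanSpace ℝ (Fin 4)) =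
      Module.finrank ℝ (WithLp 2 (ℝ × EuclideanSpace ℝ (Fin 3))) := by
    rw [(WithLp.linearEquiv 2 ℝ (ℝ × EuclideanSpace ℝ (Fin 3))).finrank_eq]
    simp
  let e₀ := (stdOrthonormalBasis ℝ (EuclideanSpace ℝ (Fin 4))).equiv
    (stdOrthonormalBasis ℝ (WithLp 2 (ℝ × EuclideanSpace ℝ (Fin 3)))) (finCongr hdim)
  have hn : ‖e₀ P‖ = ‖(WithLp.toLp 2 (1, 0) : WithLp 2 (ℝ × EuclideanSpace ℝ (Fin 3)))‖ := by
    rw [e₀.norm_map, WithLp.prod_norm_eq_of_L2]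
    simp
  exact ⟨e₀.trans (ℝ ∙ (e₀ P - WithLp.toLp 2 (1, 0)))ᗮ.reflection, by
    simpa using Submodule.reflection_sub hn⟩

lemma lintegral_inner_norm_eq_lintegral_prod {f : ℝ → ℝ → ENNReal}
    (hf : Measurable (Function.uncurry f)) (P : S3) :
    ∫⁻ x : EuclideanSpace ℝ (Fin 4), f ⟪x, (P : EuclideanSpace ℝ (Fin 4))⟫ ‖x‖ =
      ∫⁻ y : EuclideanSpace ℝ (Fin 3), ∫⁻ h : ℝ, f h √(h ^ 2 + ‖y‖ ^ 2) := by
  obtain ⟨e, he⟩ := exists_linearIsometryEquiv_prod P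
  have hm : Measurable fun z : ℝ × EuclideanSpace ℝ (Fin 3) ↦ f z.1 √(z.1 ^ 2 + ‖z.2‖ ^ 2) :=
    hf.comp (by fun_prop : Measurable fun z : ℝ × EuclideanSpace ℝ (Fin 3) ↦
      (z.1, √(z.1 ^ 2 + ‖z.2‖ ^ 2)))
  rw [← lintegral_prod_symm _ hm.aemeasurable, ← Measure.volume_eq_prod]
  rw [← (WithLp.volume_preserving_ofLp ℝ (EuclideanSpace ℝ (Fin 3))).lintegral_comp hm,
    ← e.measurePreserving.lintegral_comp
      (f := fun a ↦ f a.ofLp.1 √(a.ofLp.1 ^ 2 + ‖a.ofLp.2‖ ^ 2))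
      (hm.comp (WithLp.volume_preserving_ofLp ℝ (EuclideanSpace ℝ (Fin 3))).measurable)]
  refine lintegral_congr fun x ↦ ?_
  rw [← e.inner_map_map, he, ← e.norm_map, WithLp.prod_norm_eq_of_L2]
  simp

lemma lintegral_comp_smul_of_pos {E : Type*} [NormedAddCommGroup E] [NormedSpace ℝ E]
    [MeasurableSpace E] [BorelSpace E] [FiniteDimensional ℝ E] (μ : Measure E)
    [μ.IsAddHaarMeasure] {f : E → ENNReal} (hf : Measurable f) {r : ℝ} (hr : 0 < r) :
    ∫⁻ x, f (r • x) ∂μ = ENNReal.ofReal ((r ^ Module.finrank ℝ E)⁻¹) * ∫⁻ x, f x ∂μ := by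
  rw [← lintegral_map hf (measurable_const_smul r), Measure.map_addHaar_smul μ hr.ne',
    lintegral_smul_measure, abs_of_pos (by positivity), smul_eq_mul]

/-- Fubini in the slope variable `k = h / ‖y‖`. -/
lemma lintegral_prod_slope {g φ : ℝ → ENNReal} (hg : Measurable g) (hφ : Measurable φ) :
    ∫⁻ y : EuclideanSpace ℝ (Fin 3), ∫⁻ h : ℝ,
        g (h / √(h ^ 2 + ‖y‖ ^ 2)) * φ √(h ^ 2 + ‖y‖ ^ 2) =
      (∫⁻ y : EuclideanSpace ℝ (Fin 3), ENNReal.ofReal ‖y‖ * φ ‖y‖) *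
        ∫⁻ k : ℝ, g (k / √(1 + k ^ 2)) * ENNReal.ofReal (((1 + k ^ 2) ^ 2)⁻¹) := by
  have h0 : ∀ᵐ y : EuclideanSpace ℝ (Fin 3), y ≠ 0 := by simp [ae_iff]
  have h1 : ∀ y : EuclideanSpace ℝ (Fin 3), y ≠ 0 → ∫⁻ h : ℝ,
      g (h / √(h ^ 2 + ‖y‖ ^ 2)) * φ √(h ^ 2 + ‖y‖ ^ 2) = ∫⁻ k : ℝ,
        ENNReal.ofReal ‖y‖ * (g (k / √(1 + k ^ 2)) * φ (√(1 + k ^ 2) * ‖y‖)) := by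
    intro y hy
    have hρ : 0 < ‖y‖ := norm_pos_iff.2 hy
    have hm : Measurable fun h : ℝ ↦
        g (h / √(h ^ 2 + ‖y‖ ^ 2)) * φ √(h ^ 2 + ‖y‖ ^ 2) := by fun_prop
    have h2 := lintegral_comp_smul_of_pos volume hm hρ
    rw [Module.finrank_self, pow_one] at h2
    rw [lintegral_const_mul' _ _ ENNReal.ofReal_ne_top]
    have h3 : ∫⁻ k : ℝ, g (k / √(1 + k ^ 2)) * φ (√(1 + k ^ 2) * ‖y‖) =
        ENNReal.ofReal ‖y‖⁻¹ *
          ∫⁻ h : ℝ, g (h / √(h ^ 2 + ‖y‖ ^ 2)) * φ √(h ^ 2 + ‖y‖ ^ 2) := by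
      rw [← h2]
      refine lintegral_congr fun k ↦ ?_
      have h4 : √((‖y‖ • k) ^ 2 + ‖y‖ ^ 2) = √(1 + k ^ 2) * ‖y‖ := by
        rw [show (‖y‖ • k) ^ 2 + ‖y‖ ^ 2 = (1 + k ^ 2) * ‖y‖ ^ 2 by simp; ring,
          Real.sqrt_mul (by positivity), Real.sqrt_sq hρ.le]
      rw [h4, smul_eq_mul, mul_comm ‖y‖ k, mul_div_mul_right _ _ hρ.ne']
    rw [h3, ← mul_assoc, ← ENNReal.ofReal_mul hρ.le, mul_inv_cancel₀ hρ.ne', ENNReal.ofReal_one,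
      one_mul]
  rw [lintegral_congr_ae (h0.mono h1), lintegral_lintegral_swap (by fun_prop),
    ← lintegral_const_mul _ (by fun_prop)]
  refine lintegral_congr fun k ↦ ?_
  have ha : 0 < √(1 + k ^ 2) := by positivity
  have hψ : Measurable fun y : EuclideanSpace ℝ (Fin 3) ↦ ENNReal.ofReal ‖y‖ * φ ‖y‖ := by
    fun_prop
  have h5 := lintegral_comp_smul_of_pos volume hψ ha
  simp only [norm_smul, Real.norm_eq_abs, abs_of_pos ha, finrank_euclideanSpace,
    Fintype.card_fin] at h5
  calc ∫⁻ y : EuclideanSpace ℝ (Fin 3),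
        ENNReal.ofReal ‖y‖ * (g (k / √(1 + k ^ 2)) * φ (√(1 + k ^ 2) * ‖y‖))
      = ∫⁻ y : EuclideanSpace ℝ (Fin 3), g (k / √(1 + k ^ 2)) * ENNReal.ofReal (√(1 + k ^ 2))⁻¹ *
          (ENNReal.ofReal (√(1 + k ^ 2) * ‖y‖) * φ (√(1 + k ^ 2) * ‖y‖)) := by
        refine lintegral_congr fun y ↦ ?_
        have : ENNReal.ofReal ‖y‖ =
            ENNReal.ofReal (√(1 + k ^ 2))⁻¹ * ENNReal.ofReal (√(1 + k ^ 2) * ‖y‖) := by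
          rw [← ENNReal.ofReal_mul (by positivity), inv_mul_cancel_left₀ ha.ne']
        rw [this]
        ring
    _ = _ := by
        rw [lintegral_const_mul _ (by fun_prop), h5]
        have : ENNReal.ofReal (((1 + k ^ 2) ^ 2)⁻¹) =
            ENNReal.ofReal (√(1 + k ^ 2))⁻¹ * ENNReal.ofReal ((√(1 + k ^ 2) ^ 3)⁻¹) := by
          rw [← ENNReal.ofReal_mul (by positivity), ← mul_inv, ← pow_succ']
          congr 2
          rw [show (3 + 1) = 2 * 2 by norm_num, pow_mul, Real.sq_sqrt (by positivity)]
        rw [this]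
        ring

/-- The slope substitution `k = (1 - r²) / (2r)`, where `r` is the stereographic radius. -/
lemma lintegral_slope_eq_lintegral_stereographic (g : ℝ → ENNReal) :
    ∫⁻ k : ℝ, g (k / √(1 + k ^ 2)) * ENNReal.ofReal (((1 + k ^ 2) ^ 2)⁻¹) =
      ∫⁻ r in Ioi (0 : ℝ), g ((1 - r ^ 2) / (1 + r ^ 2)) *
        ENNReal.ofReal (8 * r ^ 2 / (1 + r ^ 2) ^ 3) := by
  have himg : (fun r : ℝ ↦ (r⁻¹ - r) / 2) '' Ioi 0 = univ := by
    refine eq_univ_of_forall fun k ↦ ⟨√(1 + k ^ 2) - k, ?_, ?_⟩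
    · rw [mem_Ioi, sub_pos]
      exact Real.lt_sqrt_of_sq_lt (by linarith)
    · have h : (√(1 + k ^ 2) - k)⁻¹ = √(1 + k ^ 2) + k := by
        refine inv_eq_of_mul_eq_one_right ?_
        nlinarith [Real.sq_sqrt (show 0 ≤ 1 + k ^ 2 by positivity)]
      simp only [h]
      ring
  have hinj : InjOn (fun r : ℝ ↦ (r⁻¹ - r) / 2) (Ioi 0) := by
    refine StrictAntiOn.injOn fun a ha b hb hab ↦ ?_
    have : b⁻¹ < a⁻¹ := inv_strictAnti₀ ha hab
    change (b⁻¹ - b) / 2 < (a⁻¹ - a) / 2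
    linarith
  have hderiv : ∀ r ∈ Ioi (0 : ℝ), HasDerivWithinAt (fun r : ℝ ↦ (r⁻¹ - r) / 2)
      ((-(r ^ 2)⁻¹ - 1) / 2) (Ioi 0) r := fun r hr ↦
    (((hasDerivAt_inv (ne_of_gt hr)).sub (hasDerivAt_id r)).div_const 2).hasDerivWithinAt
  rw [← setLIntegral_univ, ← himg,
    lintegral_image_eq_lintegral_abs_deriv_mul measurableSet_Ioi hderiv hinj]
  refine setLIntegral_congr_fun measurableSet_Ioi fun r hr ↦ ?_
  have hr : 0 < r := hr
  have h1 : 1 + ((r⁻¹ - r) / 2) ^ 2 = ((1 + r ^ 2) / (2 * r)) ^ 2 := by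
    field_simp; ring
  have h2 : (r⁻¹ - r) / 2 / √(1 + ((r⁻¹ - r) / 2) ^ 2) = (1 - r ^ 2) / (1 + r ^ 2) := by
    rw [h1, Real.sqrt_sq (by positivity)]
    field_simp
  have h3 : |(-(r ^ 2)⁻¹ - 1) / 2| = (1 + r ^ 2) / (2 * r ^ 2) := by
    rw [show (-(r ^ 2)⁻¹ - 1) / 2 = -((1 + r ^ 2) / (2 * r ^ 2)) by field_simp; ring, abs_neg,
      abs_of_pos (by positivity)]
  simp only [h2, h3]
  rw [mul_left_comm, ← ENNReal.ofReal_mul (by positivity), h1]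
  congr 2
  field_simp
  norm_num

/-- The density of the zonal pushforward of the surface measure of `S³`, in the stereographic
radius. -/
def zonalDensity (r : ℝ) : ℝ := 8 * r ^ 2 / (1 + r ^ 2) ^ 3

lemma zonalDensity_nonneg (r : ℝ) : 0 ≤ zonalDensity r := by
  unfold zonalDensity; positivity

@[fun_prop]
lemma continuous_zonalDensity : Continuous zonalDensity := by
  unfold zonalDensity
  exact Continuous.div (by fun_prop) (by fun_prop) fun r ↦ by positivity

lemma sq_mul_zonalDensity_le (r : ℝ) : r ^ 2 * zonalDensity r ≤ 8 * (1 + r ^ 2)⁻¹ := by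
  unfold zonalDensity
  rw [mul_div_assoc', ← div_eq_mul_inv, div_le_div_iff₀ (by positivity) (by positivity)]
  nlinarith [sq_nonneg r, sq_nonneg (r ^ 2), pow_nonneg (sq_nonneg r) 3]

lemma zonalDensity_le (r : ℝ) : zonalDensity r ≤ 8 * (1 + r ^ 2)⁻¹ := by
  unfold zonalDensity
  rw [← div_eq_mul_inv, div_le_div_iff₀ (by positivity) (by positivity)]
  nlinarith [sq_nonneg r, sq_nonneg (r ^ 2), pow_nonneg (sq_nonneg r) 3]

lemma integrableOn_zonalDensity : IntegrableOn zonalDensity (Ioi 0) := by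
  refine (integrable_inv_one_add_sq.const_mul 8).integrableOn.mono'
    continuous_zonalDensity.aestronglyMeasurable (.of_forall fun r ↦ ?_)
  rw [Real.norm_of_nonneg (zonalDensity_nonneg r)]
  exact zonalDensity_le r

lemma exists_lintegral_zonal :
    ∃ c : ENNReal, ∀ g : ℝ → ENNReal, Measurable g → ∀ P : S3,
      ∫⁻ x : S3, g ⟪(x : EuclideanSpace ℝ (Fin 4)), (P : EuclideanSpace ℝ (Fin 4))⟫ ∂μS3 =
        c * ∫⁻ r in Ioi (0 : ℝ), g ((1 - r ^ 2) / (1 + r ^ 2)) *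
          ENNReal.ofReal (zonalDensity r) := by
  have hφ : Measurable ((Iio (1 : ℝ)).indicator (1 : ℝ → ENNReal)) :=
    measurable_one.indicator measurableSet_Iio
  refine ⟨ENNReal.ofReal 4 * ∫⁻ y : EuclideanSpace ℝ (Fin 3),
    ENNReal.ofReal ‖y‖ * (Iio 1).indicator 1 ‖y‖, fun g hg P ↦ ?_⟩
  have h := lintegral_sphere_mul_eq_lintegral_ball hg P
  rw [lintegral_inner_norm_eq_lintegral_prod
    (f := fun a b ↦ g (a / b) * (Iio 1).indicator 1 b)
    ((hg.comp (measurable_fst.div measurable_snd)).mul (hφ.comp measurable_snd)),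
    lintegral_prod_slope hg hφ, lintegral_slope_eq_lintegral_stereographic] at h
  unfold zonalDensity
  rw [mul_assoc, ← h, mul_comm, mul_assoc, ← ENNReal.ofReal_mul (by norm_num)]
  norm_num

/-- Integrals of nonnegative zonal functions over `S³`, up to a universal constant. -/
lemma exists_integral_zonal :
    ∃ c : ℝ, ∀ f : ℝ → ℝ, Measurable f → (∀ u ∈ Icc (-1 : ℝ) 1, 0 ≤ f u) → ∀ P : S3,
      ∫ x : S3, f ⟪(x : EuclideanSpace ℝ (Fin 4)), (P : EuclideanSpace ℝ (Fin 4))⟫ ∂μS3 =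
        c * ∫ r in Ioi (0 : ℝ), f ((1 - r ^ 2) / (1 + r ^ 2)) * zonalDensity r := by
  obtain ⟨c, hc⟩ := exists_lintegral_zonal
  refine ⟨c.toReal, fun f hf hf0 P ↦ ?_⟩
  have hP : ‖(P : EuclideanSpace ℝ (Fin 4))‖ = 1 := by simp
  have hx : ∀ x : S3,
      0 ≤ f ⟪(x : EuclideanSpace ℝ (Fin 4)), (P : EuclideanSpace ℝ (Fin 4))⟫ := fun x ↦
    hf0 _ (abs_le.1 (by
      simpa using abs_real_inner_le_norm (x : EuclideanSpace ℝ (Fin 4)) P))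
  have hr : ∀ r : ℝ, 0 ≤ f ((1 - r ^ 2) / (1 + r ^ 2)) := fun r ↦ by
    refine hf0 _ ⟨?_, ?_⟩
    · rw [le_div_iff₀ (by positivity)]; linarith
    · rw [div_le_iff₀ (by positivity)]; nlinarith [sq_nonneg r]
  have hm : Measurable fun r ↦ f ((1 - r ^ 2) / (1 + r ^ 2)) * zonalDensity r := by fun_prop
  rw [integral_eq_lintegral_of_nonneg_ae (.of_forall hx)
      (hf.comp (measurable_inner_sphere P)).aestronglyMeasurable,
    integral_eq_lintegral_of_nonneg_ae
      (.of_forall fun r ↦ mul_nonneg (hr r) (zonalDensity_nonneg r))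
      hm.aestronglyMeasurable, ← ENNReal.toReal_mul, hc _ hf.ennreal_ofReal P]
  simp only [ENNReal.ofReal_mul (hr _)]

lemma measureReal_univ_μS3 : μS3.real univ = 2 * π ^ 2 := by
  rw [μS3, Measure.toSphere_real_apply_univ, measureReal_def, EuclideanSpace.volume_ball]
  have h : Real.Gamma (4 / 2 + 1) = 2 := by
    rw [show (4 / 2 + 1 : ℝ) = (2 : ℕ) + 1 by norm_num, Real.Gamma_nat_eq_factorial]
    simp
  simp [h]
  rw [show √π ^ 4 = (√π ^ 2) ^ 2 by ring, Real.sq_sqrt pi_pos.le,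
    ENNReal.toReal_ofReal (by positivity)]
  ring

/-- The bubble of parameter `s`, as a function of `q = s * r`. -/
def radialBubble (s q : ℝ) : ℝ := s * (1 + q ^ 2) / (s ^ 2 + q ^ 2)

lemma radialBubble_pos {s : ℝ} (hs : 0 < s) (q : ℝ) : 0 < radialBubble s q := by
  unfold radialBubble; positivity

/-- The conformal change of variables exchanging the exponents `3 - τ` and `τ`. -/
lemma exists_integral_bubble_rpow :
    ∃ c : ℝ, c * (∫ q in Ioi (0 : ℝ), zonalDensity q) = 2 * π ^ 2 ∧
      ∀ (P : S3) (s τ : ℝ), 0 < s → ∫ x, (bubble P s x) ^ ((3 : ℝ) - τ) ∂μS3 =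
        c * ∫ q in Ioi (0 : ℝ), radialBubble s q ^ τ * zonalDensity q := by
  obtain ⟨c, hc⟩ := exists_integral_zonal
  refine ⟨c, ?_, fun P s τ hs ↦ ?_⟩
  · have h := hc (fun _ ↦ 1) measurable_const (fun _ _ ↦ zero_le_one)
      ⟨EuclideanSpace.single 0 1, by simp⟩
    simp only [integral_const, one_mul, smul_eq_mul, mul_one, measureReal_univ_μS3] at h
    exact h.symm
  · have h := hc (fun u ↦ (s / (1 + ((s ^ 2 - 1) / 2) * (1 - u))) ^ (3 - τ)) (by fun_prop)
      (fun u hu ↦ Real.rpow_nonneg (div_nonneg hs.le (by nlinarith [hu.1, hu.2, sq_nonneg s])) _) P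
    simp only [bubble]
    rw [h]
    congr 1
    have hscale := integral_comp_mul_left_Ioi
      (fun q ↦ radialBubble s q ^ τ * zonalDensity q) 0 hs
    rw [mul_zero, smul_eq_mul, eq_inv_mul_iff_mul_eq₀ hs.ne', ← integral_const_mul] at hscale
    rw [← hscale]
    refine setIntegral_congr_fun measurableSet_Ioi fun r hr ↦ ?_
    have hr : 0 < r := hr
    have h1 : s / (1 + ((s ^ 2 - 1) / 2) * (1 - (1 - r ^ 2) / (1 + r ^ 2))) =
        s * (1 + r ^ 2) / (1 + s ^ 2 * r ^ 2) := by
      have : 1 + ((s ^ 2 - 1) / 2) * (1 - (1 - r ^ 2) / (1 + r ^ 2)) =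
          (1 + s ^ 2 * r ^ 2) / (1 + r ^ 2) := by
        field_simp; ring
      rw [this, div_div_eq_mul_div]
    have h2 : radialBubble s (s * r) = (s * (1 + r ^ 2) / (1 + s ^ 2 * r ^ 2))⁻¹ := by
      unfold radialBubble
      field_simp
    have hpos : 0 < s * (1 + r ^ 2) / (1 + s ^ 2 * r ^ 2) := by positivity
    simp only [h1, h2]
    rw [Real.inv_rpow hpos.le, Real.rpow_sub hpos]
    have : s * zonalDensity (s * r) =
        (s * (1 + r ^ 2) / (1 + s ^ 2 * r ^ 2)) ^ (3 : ℝ) * zonalDensity r := by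
      rw [show (3 : ℝ) = (3 : ℕ) by norm_num, Real.rpow_natCast]
      unfold zonalDensity
      field_simp
    rw [mul_left_comm, this]
    ring

lemma continuous_radialBubble_rpow {s : ℝ} (hs : 0 < s) (τ : ℝ) :
    Continuous fun q ↦ radialBubble s q ^ τ := by
  have h : Continuous (radialBubble s) := by
    unfold radialBubble
    exact Continuous.div (by fun_prop) (by fun_prop) fun q ↦ by positivity
  exact h.rpow_const fun q ↦ .inl (radialBubble_pos hs q).ne'

lemma radialBubble_rpow_le {s τ : ℝ} (hs : 0 < s) (hτ : τ ∈ Ioo (0 : ℝ) 1) (q : ℝ) :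
    radialBubble s q ^ τ ≤ 1 + s + s⁻¹ := by
  have h1 : radialBubble s q ≤ s + s⁻¹ := by
    unfold radialBubble
    rw [div_le_iff₀ (by positivity)]
    have : (s + s⁻¹) * (s ^ 2 + q ^ 2) = s * (1 + q ^ 2) + s ^ 3 + s⁻¹ * q ^ 2 := by
      field_simp; ring
    rw [this]
    have := pow_pos hs 3
    have := mul_nonneg (inv_pos.2 hs).le (sq_nonneg q)
    linarith
  have h0 := radialBubble_pos hs q
  rcases le_total (radialBubble s q) 1 with h | h
  · have := Real.rpow_le_one h0.le h hτ.1.le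
    have := inv_pos.2 hs
    linarith
  · have := Real.rpow_le_rpow_of_exponent_le h hτ.2.le
    rw [Real.rpow_one] at this
    linarith

lemma hasDerivAt_radialBubble_rpow {s : ℝ} (hs : 0 < s) (τ q : ℝ) :
    HasDerivAt (fun s ↦ radialBubble s q ^ τ)
      (τ / s * (radialBubble s q ^ τ * (2 * (q ^ 2 / (s ^ 2 + q ^ 2)) - 1))) s := by
  have h0 := radialBubble_pos hs q
  have h1 : HasDerivAt (fun s ↦ radialBubble s q)
      (radialBubble s q * ((2 * (q ^ 2 / (s ^ 2 + q ^ 2)) - 1) / s)) s := by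
    unfold radialBubble
    refine (((hasDerivAt_id s).mul_const (1 + q ^ 2)).div
      ((hasDerivAt_pow 2 s).add_const (q ^ 2)) (by positivity)).congr_deriv ?_
    simp only [id]
    field_simp
    ring
  refine (h1.rpow_const (.inl h0.ne')).congr_deriv ?_
  rw [Real.rpow_sub_one h0.ne']
  field_simp

lemma abs_two_mul_sub_one_le {s : ℝ} (hs : 0 < s) (q : ℝ) :
    |2 * (q ^ 2 / (s ^ 2 + q ^ 2)) - 1| ≤ 1 := by
  have h1 : 0 ≤ q ^ 2 / (s ^ 2 + q ^ 2) := by positivity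
  have h2 : q ^ 2 / (s ^ 2 + q ^ 2) ≤ 1 := by
    rw [div_le_one (by positivity)]
    linarith [sq_nonneg s]
  rw [abs_le]
  constructor <;> linarith

lemma integrableOn_and_hasDerivAt_integral_radialBubble_rpow {t τ : ℝ} (ht : 0 < t)
    (hτ : τ ∈ Ioo (0 : ℝ) 1) :
    IntegrableOn (fun q ↦ radialBubble t q ^ τ * (2 * (q ^ 2 / (t ^ 2 + q ^ 2)) - 1) *
        zonalDensity q) (Ioi 0) ∧
      HasDerivAt (fun s ↦ ∫ q in Ioi (0 : ℝ), radialBubble s q ^ τ * zonalDensity q)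
        (τ / t * ∫ q in Ioi (0 : ℝ), radialBubble t q ^ τ *
          (2 * (q ^ 2 / (t ^ 2 + q ^ 2)) - 1) * zonalDensity q) t := by
  have hc : Continuous fun q : ℝ ↦ 2 * (q ^ 2 / (t ^ 2 + q ^ 2)) - 1 :=
    ((Continuous.div (by fun_prop) (by fun_prop) fun q ↦ by positivity).const_mul 2).sub
      continuous_const
  have hb := continuous_radialBubble_rpow ht τ
  have hs : ∀ s ∈ Ioo (t / 2) (2 * t), 0 < s := fun s hs ↦ (half_pos ht).trans hs.1
  have hF : ∀ s, 0 < s → ∀ q, |radialBubble s q ^ τ| ≤ 1 + s + s⁻¹ := fun s hs q ↦ by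
    rw [abs_of_pos (Real.rpow_pos_of_pos (radialBubble_pos hs q) _)]
    exact radialBubble_rpow_le hs hτ q
  have key := hasDerivAt_integral_of_dominated_loc_of_deriv_le
    (μ := volume.restrict (Ioi (0 : ℝ))) (x₀ := t) (s := Ioo (t / 2) (2 * t))
    (F := fun s q ↦ radialBubble s q ^ τ * zonalDensity q)
    (F' := fun s q ↦ τ / s * (radialBubble s q ^ τ * (2 * (q ^ 2 / (s ^ 2 + q ^ 2)) - 1)) *
      zonalDensity q)
    (bound := fun q ↦ 2 / t * ((1 + 2 * t + 2 / t) * 1) * zonalDensity q)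
    (Ioo_mem_nhds (by linarith) (by linarith))
    ((lt_mem_nhds ht).mono fun s hs ↦
      ((continuous_radialBubble_rpow hs τ).mul continuous_zonalDensity).aestronglyMeasurable)
    (integrableOn_zonalDensity.bdd_mul hb.aestronglyMeasurable (.of_forall (hF t ht)))
    (by fun_prop)
    (.of_forall fun q s hst ↦ by
      have hs0 := hs s hst
      rw [norm_mul, norm_mul, norm_mul, Real.norm_of_nonneg (zonalDensity_nonneg q),
        Real.norm_of_nonneg (div_nonneg hτ.1.le hs0.le)]
      have h1 : s⁻¹ ≤ 2 / t := by
        rw [inv_le_comm₀ hs0 (by positivity), inv_div]; exact hst.1.le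
      have h2 : τ / s ≤ 2 / t := by
        rw [div_eq_mul_inv]
        nlinarith [hτ.1, hτ.2, inv_pos.2 hs0]
      gcongr
      · exact zonalDensity_nonneg q
      · exact (hF s hs0 q).trans (by linarith [hst.2])
      · exact abs_two_mul_sub_one_le hs0 q)
    (integrableOn_zonalDensity.const_mul _)
    (.of_forall fun q s hst ↦ (hasDerivAt_radialBubble_rpow (hs s hst) τ q).mul_const _)
  refine ⟨?_, ?_⟩
  · refine integrableOn_zonalDensity.bdd_mul (c := (1 + t + t⁻¹) * 1)
      (hb.mul hc).aestronglyMeasurable (.of_forall fun q ↦ ?_)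
    rw [norm_mul]
    exact mul_le_mul (hF t ht q) (abs_two_mul_sub_one_le ht q) (norm_nonneg _) (by positivity)
  · rw [← integral_const_mul]
    simpa only [mul_assoc] using key.2

lemma abs_radialBubble_rpow_sub_one_le {s τ : ℝ} (hs : 1 ≤ s) (hτ : 0 < τ)
    (h : τ * Real.log s ≤ 1) (q : ℝ) :
    |radialBubble s q ^ τ - 1| ≤ 2 * (τ * Real.log s) := by
  have hs0 : 0 < s := by linarith
  have h0 := radialBubble_pos hs0 q
  have h1 : radialBubble s q ≤ s := by
    unfold radialBubble
    rw [div_le_iff₀ (by positivity)]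
    exact mul_le_mul_of_nonneg_left (by nlinarith) hs0.le
  have h2 : s⁻¹ ≤ radialBubble s q := by
    unfold radialBubble
    rw [le_div_iff₀ (by positivity), inv_mul_le_iff₀ hs0]
    nlinarith [mul_nonneg (sub_nonneg.2 hs) (sq_nonneg q),
      mul_nonneg (mul_nonneg hs0.le (sub_nonneg.2 hs)) (sq_nonneg q)]
  have h3 : |Real.log (radialBubble s q) * τ| ≤ τ * Real.log s := by
    rw [abs_mul, abs_of_pos hτ, mul_comm]
    refine mul_le_mul_of_nonneg_left (abs_le.2 ⟨?_, Real.log_le_log h0 h1⟩) hτ.le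
    rw [← Real.log_inv]
    exact Real.log_le_log (inv_pos.2 hs0) h2
  rw [Real.rpow_def_of_pos h0]
  exact (Real.abs_exp_sub_one_le (h3.trans h)).trans (by linarith)

lemma abs_integral_add_integral_zonalDensity_le {s τ : ℝ} (hs : 1 ≤ s) (hτ : τ ∈ Ioo (0 : ℝ) 1)
    (h : τ * Real.log s ≤ 1) :
    |(∫ q in Ioi (0 : ℝ), radialBubble s q ^ τ * (2 * (q ^ 2 / (s ^ 2 + q ^ 2)) - 1) *
        zonalDensity q) + ∫ q in Ioi (0 : ℝ), zonalDensity q| ≤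
      2 * (τ * Real.log s) * (∫ q in Ioi (0 : ℝ), zonalDensity q) + 24 * π / s ^ 2 := by
  have hs0 : 0 < s := by linarith
  rw [← integral_add (integrableOn_and_hasDerivAt_integral_radialBubble_rpow hs0 hτ).1
    integrableOn_zonalDensity, ← Real.norm_eq_abs]
  have hi : IntegrableOn (fun q : ℝ ↦ 48 / s ^ 2 * (1 + q ^ 2)⁻¹) (Ioi 0) :=
    (integrable_inv_one_add_sq.const_mul _).integrableOn
  have hW := integrableOn_zonalDensity.const_mul (2 * (τ * Real.log s))
  refine (norm_integral_le_of_norm_le (hW.add hi) (.of_forall fun q ↦ ?_)).trans_eq ?_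
  · have h1 := abs_radialBubble_rpow_sub_one_le hs hτ.1 h q
    have hw := zonalDensity_nonneg q
    have hx : 0 ≤ q ^ 2 / (s ^ 2 + q ^ 2) := by positivity
    have h2 : q ^ 2 / (s ^ 2 + q ^ 2) * zonalDensity q ≤ 8 / s ^ 2 * (1 + q ^ 2)⁻¹ := by
      calc q ^ 2 / (s ^ 2 + q ^ 2) * zonalDensity q ≤ q ^ 2 / s ^ 2 * zonalDensity q := by
            gcongr; linarith [sq_nonneg q]
        _ = q ^ 2 * zonalDensity q / s ^ 2 := by ring
        _ ≤ 8 * (1 + q ^ 2)⁻¹ / s ^ 2 :=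
            div_le_div_of_nonneg_right (sq_mul_zonalDensity_le q) (by positivity)
        _ = _ := by ring
    set D := radialBubble s q ^ τ
    have hD : D ≤ 3 := by linarith [(abs_le.1 h1).2]
    have hD0 : 0 ≤ D := Real.rpow_nonneg (radialBubble_pos hs0 q).le _
    set x := q ^ 2 / (s ^ 2 + q ^ 2)
    calc ‖D * (2 * x - 1) * zonalDensity q + zonalDensity q‖
        = ‖2 * D * (x * zonalDensity q) - (D - 1) * zonalDensity q‖ := by congr 1; ring
      _ ≤ ‖2 * D * (x * zonalDensity q)‖ + ‖(D - 1) * zonalDensity q‖ := norm_sub_le _ _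
      _ = 2 * D * (x * zonalDensity q) + |D - 1| * zonalDensity q := by
          rw [Real.norm_of_nonneg (by positivity), norm_mul, Real.norm_of_nonneg hw,
            Real.norm_eq_abs]
      _ ≤ 2 * 3 * (8 / s ^ 2 * (1 + q ^ 2)⁻¹) +
          2 * (τ * Real.log s) * zonalDensity q := by gcongr
      _ = _ := by simp only [Pi.add_apply]; ring
  · rw [integral_add' hW hi, integral_const_mul, integral_const_mul,
      integral_Ioi_inv_one_add_sq, arctan_zero]
    ring

theorem stmt13 (A : ℝ) (hA : 1 ≤ A) :
    ∃ C > 0, ∃ τ₀ ∈ Set.Ioo (0 : ℝ) 1, ∀ τ ∈ Set.Ioo (0 : ℝ) τ₀, ∀ P₁ : S3, ∀ t₁ : ℝ,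
      A⁻¹ * τ ^ (-(1 : ℝ) / 2) < t₁ → t₁ < A * τ ^ (-(1 : ℝ) / 2) →
      |deriv (fun s => ∫ x, (bubble P₁ s x) ^ ((3 : ℝ) - τ) ∂μS3) t₁ +
          2 * π ^ 2 * (τ / t₁)| ≤ C * τ ^ ((5 : ℝ) / 2) * |Real.log τ| := by
  obtain ⟨c, hcW, hc⟩ := exists_integral_bubble_rpow
  set W := ∫ q in Ioi (0 : ℝ), zonalDensity q
  have hW : 0 ≤ W := integral_nonneg zonalDensity_nonneg
  have hA0 : 0 < A := by linarith
  have he : Real.exp (-1) < 1 := by simp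
  have hA2 : 1 ≤ A ^ 2 := one_le_pow₀ hA
  refine ⟨|c| * A * (2 * W + 24 * π * A ^ 2) + 1, by positivity, Real.exp (-1) / A ^ 2,
    ⟨by positivity, (div_lt_one (by positivity)).2 (he.trans_le hA2)⟩, ?_⟩
  rintro τ ⟨hτ0, hτ⟩ P t ht1 ht2
  have hτe : τ < Real.exp (-1) := hτ.trans_le (div_le_self (Real.exp_pos _).le hA2)
  have hτ1 : τ < 1 := hτe.trans he
  have hτA : τ * A ^ 2 < 1 := ((lt_div_iff₀ (by positivity)).1 hτ).trans he
  have hlog : Real.log τ ≤ -1 := by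
    rw [← Real.log_exp (-1)]
    exact Real.log_le_log hτ0 hτe.le
  have habs : |Real.log τ| = -Real.log τ := abs_of_nonpos (by linarith)
  have hrpow : τ ^ (-(1 : ℝ) / 2) = (√τ)⁻¹ := by
    rw [neg_div, Real.rpow_neg hτ0.le, ← Real.sqrt_eq_rpow]
  rw [hrpow] at ht1 ht2
  have hr : 0 < √τ := Real.sqrt_pos.2 hτ0
  have hr2 : √τ ^ 2 = τ := Real.sq_sqrt hτ0.le
  have hAr : A * √τ < 1 := by
    refine lt_of_pow_lt_pow_left₀ 2 zero_le_one ?_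
    rw [mul_pow, hr2]
    linarith
  have ht : 1 ≤ t := by
    refine le_trans ?_ ht1.le
    rw [← mul_inv]
    exact (one_le_inv₀ (by positivity)).2 hAr.le
  have ht0 : 0 < t := by linarith
  have htinv : t⁻¹ ≤ A * √τ := by
    rw [inv_le_comm₀ ht0 (by positivity), mul_inv]
    exact ht1.le
  have hlogt : Real.log t ≤ |Real.log τ| := by
    rw [habs, ← Real.log_inv]
    refine Real.log_le_log ht0 (ht2.le.trans ?_)
    calc A * (√τ)⁻¹ = A * √τ * (√τ ^ 2)⁻¹ := by field_simp
      _ ≤ 1 * τ⁻¹ := by rw [hr2]; gcongr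
      _ = τ⁻¹ := one_mul _
  have hτlog : τ * |Real.log τ| ≤ 1 := by
    rw [habs, ← Real.log_inv]
    have := Real.log_le_sub_one_of_pos (inv_pos.2 hτ0)
    calc τ * Real.log τ⁻¹ ≤ τ * τ⁻¹ := by gcongr; linarith
      _ = 1 := mul_inv_cancel₀ hτ0.ne'
  have hτt : τ * Real.log t ≤ τ * |Real.log τ| := by gcongr
  have hderiv : deriv (fun s => ∫ x, (bubble P s x) ^ ((3 : ℝ) - τ) ∂μS3) t = c * (τ / t *
      ∫ q in Ioi (0 : ℝ), radialBubble t q ^ τ *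
        (2 * (q ^ 2 / (t ^ 2 + q ^ 2)) - 1) * zonalDensity q) := by
    refine (((integrableOn_and_hasDerivAt_integral_radialBubble_rpow ht0
      ⟨hτ0, hτ1⟩).2.const_mul c).congr_of_eventuallyEq ?_).deriv
    exact (lt_mem_nhds ht0).mono fun s hs ↦ hc P s τ hs
  have hmain := abs_integral_add_integral_zonalDensity_le ht ⟨hτ0, hτ1⟩ (hτt.trans hτlog)
  rw [hderiv, ← hcW]
  set I := ∫ q in Ioi (0 : ℝ), radialBubble t q ^ τ *
    (2 * (q ^ 2 / (t ^ 2 + q ^ 2)) - 1) * zonalDensity q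
  have hpow : τ ^ ((5 : ℝ) / 2) = τ * √τ * τ := by
    rw [show (5 : ℝ) / 2 = 1 + 1 / 2 + 1 by norm_num, Real.rpow_add hτ0, Real.rpow_add hτ0,
      Real.rpow_one, ← Real.sqrt_eq_rpow]
  have hbr : |I + W| ≤ (2 * W + 24 * π * A ^ 2) * (τ * |Real.log τ|) := by
    have h1 : 24 * π / t ^ 2 ≤ 24 * π * A ^ 2 * (τ * |Real.log τ|) := by
      calc 24 * π / t ^ 2 = 24 * π * (t⁻¹) ^ 2 := by rw [inv_pow, div_eq_mul_inv]
        _ ≤ 24 * π * (A * √τ) ^ 2 := by gcongr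
        _ = 24 * π * A ^ 2 * (τ * 1) := by rw [mul_pow, hr2]; ring
        _ ≤ _ := by
          gcongr
          rw [habs]
          linarith
    have h2 : 2 * (τ * Real.log t) * W ≤ 2 * (τ * |Real.log τ|) * W := by gcongr
    linarith
  calc |c * (τ / t * I) + c * W * (τ / t)| = |c * (τ * t⁻¹) * (I + W)| := by
        congr 1; ring
    _ = |c| * (τ * t⁻¹) * |I + W| := by
        rw [abs_mul, abs_mul, abs_of_nonneg (show 0 ≤ τ * t⁻¹ by positivity)]
    _ ≤ |c| * (τ * (A * √τ)) * ((2 * W + 24 * π * A ^ 2) * (τ * |Real.log τ|)) := by gcongr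
    _ = |c| * A * (2 * W + 24 * π * A ^ 2) * τ ^ ((5 : ℝ) / 2) * |Real.log τ| := by
        rw [hpow]; ring
    _ ≤ _ := by
        gcongr
        linarith
end
end
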